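/- Fix q > 0 and λ > 0 with λ ≠ q. Then lim_{ε↓0} liminf_{n→∞} (1/n) log Z_{n,λ,q}[B_{εn}] = lim_{ε↓0} limsup_{n→∞} (1/n) log Z_{n,λ,q}[B_{εn}] = lim_{n→∞} (1/n) log Z_{n,λ,q}[L] = Ψ(λ/q) − ((q−1)/(2q))λ + log q, and the convergence is uniform for λ belonging to compact subsets of (0,∞)∖{q}. -/

import Mathlib

open Filter Topology Set

noncomputable section

/-- Size of the connected component of `K_n(ω)` containing the vertex `v`. -/
def compSize {n : ℕ} (G : SimpleGraph (Fin n)) (v : Fin n) : ℕ :=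
  (G.connectedComponentMk v).supp.ncard

/-- Random cluster weight of a configuration `G` on the complete graph `K_m`,
with edge weight `p` and cluster weight `q`. -/
def rcW (m : ℕ) (p q : ℝ) (G : SimpleGraph (Fin m)) : ℝ :=
  p ^ G.edgeSet.ncard * (1 - p) ^ (m * (m - 1) / 2 - G.edgeSet.ncard) *
    q ^ Nat.card G.ConnectedComponent

/-- Total random-cluster weight of an event, with explicit edge weight `p`. -/
def ZP (m : ℕ) (p q : ℝ) (A : Set (SimpleGraph (Fin m))) : ℝ :=
  ∑ᶠ G ∈ A, rcW m p q G

/-- `Z_{n,λ,q}[A]`, i.e. the total weight of the event `A` with `p = λ/n`. -/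
def Zrc (n : ℕ) (lam q : ℝ) (A : Set (SimpleGraph (Fin n))) : ℝ :=
  ZP n (lam / n) q A

/-- The partition function `Z_{n,λ,q}`. -/
def Ztot (n : ℕ) (lam q : ℝ) : ℝ := Zrc n lam q Set.univ

/-- The random cluster probability `φ_{n,λ,q}[A]`. -/
def phiRC (n : ℕ) (lam q : ℝ) (A : Set (SimpleGraph (Fin n))) : ℝ :=
  Zrc n lam q A / Ztot n lam q

/-- The event `K` that the configuration is connected. -/
def Kev (n : ℕ) : Set (SimpleGraph (Fin n)) := {G | G.Connected}

/-- The event `B_r` that no connected component has size larger than `r`. -/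
def Bev (n : ℕ) (r : ℝ) : Set (SimpleGraph (Fin n)) :=
  {G | ∀ v, (compSize G v : ℝ) ≤ r}

/-- The event `L` that the configuration is acyclic. -/
def Lev (n : ℕ) : Set (SimpleGraph (Fin n)) := {G | G.IsAcyclic}

/-- The set `V_r` of vertices lying in components of size larger than `r`. -/
def Vbig {n : ℕ} (G : SimpleGraph (Fin n)) (r : ℝ) : Set (Fin n) :=
  {v | r < (compSize G v : ℝ)}

/-- The number `N_r` of connected components of size larger than `r`. -/
def Nbig {n : ℕ} (G : SimpleGraph (Fin n)) (r : ℝ) : ℕ :=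
  {C : G.ConnectedComponent | r < (C.supp.ncard : ℝ)}.ncard

def pi1 (x : ℝ) : ℝ := 1 - Real.exp (-x)

def Psi (x : ℝ) : ℝ := min (Real.log x - (x - 1/x) / 2) 0

def Sent (θ : ℝ) : ℝ := θ * Real.log θ + (1 - θ) * Real.log (1 - θ)

def Phi (θ lam q : ℝ) : ℝ :=
  -Sent θ + (1 - θ) * Real.log (1 - pi1 (lam * θ)) + θ * Real.log (pi1 (lam * θ)) +
    (1 - θ) * (Psi (lam * (1 - θ) / q) - ((q - 1) / (2 * q)) * (lam * (1 - θ)) + Real.log q)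

/-! ### Combinatorics of trees and forests -/

section Combi
open Classical

variable {V : Type*}

lemma closed_reach {G : SimpleGraph V} {X : Set V} (h : ∀ a b, a ∈ X → G.Adj a b → b ∈ X)
    {a b : V} (ha : a ∈ X) (r : G.Reachable a b) : b ∈ X := by
  obtain ⟨p⟩ := r
  induction p with
  | nil => exact ha
  | cons hadj _ ih => exact ih (h _ _ ha hadj)

/-- Restriction of a graph to the edges with both endpoints in `B`. -/
def rst (G : SimpleGraph V) (B : Set V) : SimpleGraph V where
  Adj a b := G.Adj a b ∧ a ∈ B ∧ b ∈ B
  symm := ⟨fun _ _ h => ⟨h.1.symm, h.2.2, h.2.1⟩⟩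
  loopless := ⟨fun a h => G.loopless.irrefl a h.1⟩

@[simp] lemma rst_adj (G : SimpleGraph V) (B : Set V) (a b : V) :
    (rst G B).Adj a b ↔ G.Adj a b ∧ a ∈ B ∧ b ∈ B := Iff.rfl

lemma rst_le (G : SimpleGraph V) (B : Set V) : rst G B ≤ G := fun _ _ h => h.1

/-- reachability inside a `G`-closed set -/
lemma reach_rst {G H : SimpleGraph V} {X : Set V} (h : ∀ a b, a ∈ X → G.Adj a b → b ∈ X ∧ H.Adj a b)
    {a b : V} (ha : a ∈ X) (r : G.Reachable a b) : H.Reachable a b := by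
  have := closed_reach (G := G) (X := {c | c ∈ X ∧ H.Reachable a c}) ?_ ⟨ha, .rfl⟩ r
  · exact this.2
  · rintro c d ⟨hc, hr⟩ hcd
    exact ⟨(h c d hc hcd).1, hr.trans (h c d hc hcd).2.reachable⟩

lemma acyclic_disj {G H : SimpleGraph V} {B : Set V} (hG : G.IsAcyclic) (hH : H.IsAcyclic)
    (hGB : ∀ a b, G.Adj a b → a ∈ B) (hHB : ∀ a b, H.Adj a b → a ∉ B) : (G ⊔ H).IsAcyclic := by
  rw [SimpleGraph.isAcyclic_iff_forall_adj_isBridge] at *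
  intro a b hab
  rw [SimpleGraph.isBridge_iff]
  intro hr
  rcases hab with hab | hab
  · refine hG hab ?_
    refine reach_rst (X := B) ?_ (hGB _ _ hab) hr
    intro c d hc hcd
    rw [SimpleGraph.deleteEdges_adj] at hcd
    obtain ⟨h1 | h1, h2⟩ := hcd
    · exact ⟨hGB _ _ h1.symm, by rw [SimpleGraph.deleteEdges_adj]; exact ⟨h1, h2⟩⟩
    · exact absurd hc (hHB _ _ h1)
  · refine hH hab ?_
    refine reach_rst (X := Bᶜ) ?_ (hHB _ _ hab) hr
    intro c d hc hcd
    rw [SimpleGraph.deleteEdges_adj] at hcd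
    obtain ⟨h1 | h1, h2⟩ := hcd
    · exact absurd (hGB _ _ h1) hc
    · exact ⟨hHB _ _ h1.symm, by rw [SimpleGraph.deleteEdges_adj]; exact ⟨h1, h2⟩⟩

/-- `G` is a tree on the vertex set `S`. -/
def IsTr (S : Finset V) (G : SimpleGraph V) : Prop :=
  G.IsAcyclic ∧ (∀ a b, G.Adj a b → a ∈ S) ∧ ∀ a ∈ S, ∀ b ∈ S, G.Reachable a b

/-- `G` is a forest on the vertex set `S`, components of size at most `K`. -/
def IsFo (K : ℕ) (S : Finset V) (G : SimpleGraph V) : Prop :=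
  G.IsAcyclic ∧ (∀ a b, G.Adj a b → a ∈ S) ∧ ∀ a ∈ S, {b | G.Reachable a b}.ncard ≤ K

/-- number of edges -/
def eN (G : SimpleGraph V) : ℕ := G.edgeSet.ncard

variable [Fintype V]

lemma eN_disj {G H : SimpleGraph V} {B : Set V}
    (hGB : ∀ a b, G.Adj a b → a ∈ B) (hHB : ∀ a b, H.Adj a b → a ∉ B) :
    eN (G ⊔ H) = eN G + eN H := by
  unfold eN
  rw [SimpleGraph.edgeSet_sup, Set.ncard_union_eq _ (Set.toFinite _) (Set.toFinite _)]
  rw [Set.disjoint_left]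
  intro e
  induction e with | _ a b =>
  intro h1 h2
  exact hHB _ _ h2 (hGB _ _ h1)

lemma eN_edge {G : SimpleGraph V} {a b : V} (hab : a ≠ b) (h : ¬ G.Adj a b) :
    eN (G ⊔ SimpleGraph.edge a b) = eN G + 1 := by
  have he : (SimpleGraph.edge a b).edgeSet = {s(a, b)} := by
    ext e
    induction e with | _ c d =>
    simp only [SimpleGraph.mem_edgeSet, SimpleGraph.edge_adj, Set.mem_singleton_iff, Sym2.eq_iff]
    constructor
    · intro h; exact h.1
    · rintro (h | h)
      · exact ⟨Or.inl h, by rw [h.1, h.2]; exact hab⟩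
      · exact ⟨Or.inr h, by rw [h.1, h.2]; exact hab.symm⟩
  unfold eN
  rw [SimpleGraph.edgeSet_sup, he, Set.ncard_union_eq _ (Set.toFinite _) (Set.toFinite _)]
  · simp
  · rw [Set.disjoint_left]
    intro e h1 h2
    rw [Set.mem_singleton_iff] at h2
    subst h2
    exact h h1

/-- The four pieces glue to a tree. -/
lemma glue_tr {S B : Finset V} {v w : V} (hBS : B ⊆ S) (hv : v ∈ S) (hvB : v ∉ B) (hw : w ∈ B)
    {T₁ T₂ : SimpleGraph V} (h₁ : IsTr B T₁) (h₂ : IsTr (S \ B) T₂) :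
    IsTr S (T₁ ⊔ T₂ ⊔ SimpleGraph.edge v w) ∧
      eN (T₁ ⊔ T₂ ⊔ SimpleGraph.edge v w) = eN T₁ + eN T₂ + 1 := by
  have hvw : v ≠ w := fun h => hvB (h ▸ hw)
  have e1 : ∀ a b, T₁.Adj a b → a ∈ (B : Set V) := h₁.2.1
  have e2 : ∀ a b, T₂.Adj a b → a ∉ (B : Set V) := fun a b h =>
    (Finset.mem_sdiff.1 (h₂.2.1 a b h)).2
  have hnr : ¬ (T₁ ⊔ T₂).Reachable v w := by
    intro h
    have := closed_reach (G := T₁ ⊔ T₂) (X := (B : Set V)ᶜ) ?_ hvB h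
    · exact this hw
    · rintro a b ha (hab | hab)
      · exact absurd (e1 _ _ hab) ha
      · exact e2 _ _ hab.symm
  refine ⟨⟨(acyclic_disj h₁.1 h₂.1 e1 e2).sup_edge_of_not_reachable hnr, ?_, ?_⟩, ?_⟩
  · rintro a b ((h | h) | h)
    · exact hBS (h₁.2.1 _ _ h)
    · exact (Finset.mem_sdiff.1 (h₂.2.1 _ _ h)).1
    · rw [SimpleGraph.edge_adj] at h
      rcases h.1 with h | h
      · rw [h.1]; exact hv
      · rw [h.1]; exact hBS hw
  · have key : ∀ a ∈ S, (T₁ ⊔ T₂ ⊔ SimpleGraph.edge v w).Reachable a v := by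
      intro a ha
      by_cases haB : a ∈ B
      · have r1 : (T₁ ⊔ T₂ ⊔ SimpleGraph.edge v w).Reachable a w :=
          (h₁.2.2 a haB w hw).mono (le_sup_left.trans le_sup_left)
        refine r1.trans (SimpleGraph.Adj.reachable ?_)
        right
        rw [SimpleGraph.edge_adj]
        exact ⟨Or.inr ⟨rfl, rfl⟩, hvw.symm⟩
      · exact (h₂.2.2 a (by simp [ha, haB]) v (by simp [hv, hvB])).mono
          (le_sup_right.trans le_sup_left)
    intro a ha b hb
    exact (key a ha).trans (key b hb).symm
  · rw [eN_edge hvw (fun h => hnr h.reachable), eN_disj e1 e2]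

lemma glue_inj_sub {S B B' : Finset V} {v w w' u : V} (hv : v ∉ B) (hv' : v ∉ B')
    (hu : u ∈ B) (hu' : u ∈ B')
    {T₁ T₂ T₁' T₂' : SimpleGraph V} (h₁ : IsTr B T₁) (h₂ : IsTr (S \ B) T₂)
    (h₁' : IsTr B' T₁')
    (he : T₁ ⊔ T₂ ⊔ SimpleGraph.edge v w = T₁' ⊔ T₂' ⊔ SimpleGraph.edge v w') : B' ⊆ B := by
  intro b hb
  have := closed_reach (G := T₁') (X := (B : Set V)) ?_ hu (h₁'.2.2 u hu' b hb)
  · exact this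
  · intro a c ha hac
    have hh : (T₁ ⊔ T₂ ⊔ SimpleGraph.edge v w).Adj a c := by
      rw [he]; exact Or.inl (Or.inl hac)
    rcases hh with (h | h) | h
    · exact h₁.2.1 _ _ h.symm
    · exact absurd ha (Finset.mem_sdiff.1 (h₂.2.1 _ _ h)).2
    · rw [SimpleGraph.edge_adj] at h
      rcases h.1 with h | h
      · exact absurd (h.1 ▸ ha) hv
      · exact absurd (h.2 ▸ h₁'.2.1 _ _ hac.symm) hv'

lemma glue_inj_w {B : Finset V} {S : Finset V} {v w w' : V} (hv : v ∉ B) (hw' : w' ∈ B)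
    {T₁ T₂ T₁' T₂' : SimpleGraph V} (h₁ : IsTr B T₁) (h₂ : IsTr (S \ B) T₂)
    (he : T₁ ⊔ T₂ ⊔ SimpleGraph.edge v w = T₁' ⊔ T₂' ⊔ SimpleGraph.edge v w') : w' = w := by
  have hvw : v ≠ w' := fun h => hv (h ▸ hw')
  have hh : (T₁ ⊔ T₂ ⊔ SimpleGraph.edge v w).Adj v w' := by
    rw [he]; right; rw [SimpleGraph.edge_adj]; exact ⟨Or.inl ⟨rfl, rfl⟩, hvw⟩
  rcases hh with (h | h) | h
  · exact absurd (h₁.2.1 _ _ h) hv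
  · exact absurd hw' (Finset.mem_sdiff.1 (h₂.2.1 _ _ h.symm)).2
  · rw [SimpleGraph.edge_adj] at h
    rcases h.1 with h | h
    · exact h.2
    · exact absurd h.2.symm hvw

lemma glue_rst {B S : Finset V} {v w : V} (hv : v ∉ B) (hw : w ∈ B)
    {T₁ T₂ : SimpleGraph V} (h₁ : IsTr B T₁) (h₂ : IsTr (S \ B) T₂) :
    rst (T₁ ⊔ T₂ ⊔ SimpleGraph.edge v w) B = T₁ ∧
      rst (T₁ ⊔ T₂ ⊔ SimpleGraph.edge v w) (B : Set V)ᶜ = T₂ := by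
  constructor
  · ext a b
    simp only [rst_adj, SimpleGraph.sup_adj, SimpleGraph.edge_adj]
    constructor
    · rintro ⟨(h | h) | h, ha, hb⟩
      · exact h
      · exact absurd ha (Finset.mem_sdiff.1 (h₂.2.1 _ _ h)).2
      · rcases h.1 with h | h
        · exact absurd (h.1 ▸ ha) hv
        · exact absurd (h.2 ▸ hb) hv
    · intro h
      exact ⟨Or.inl (Or.inl h), h₁.2.1 _ _ h, h₁.2.1 _ _ h.symm⟩
  · ext a b
    simp only [rst_adj, SimpleGraph.sup_adj, SimpleGraph.edge_adj]
    constructor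
    · rintro ⟨(h | h) | h, ha, hb⟩
      · exact absurd (h₁.2.1 _ _ h) ha
      · exact h
      · rcases h.1 with h | h
        · exact absurd (h.2 ▸ hw) hb
        · exact absurd (h.1 ▸ hw) ha
    · intro h
      exact ⟨Or.inl (Or.inr h), (Finset.mem_sdiff.1 (h₂.2.1 _ _ h)).2,
        (Finset.mem_sdiff.1 (h₂.2.1 _ _ h.symm)).2⟩

lemma glue_surj {S : Finset V} {u v : V} (hu : u ∈ S) (hv : v ∈ S) (huv : u ≠ v)
    {T : SimpleGraph V} (hT : IsTr S T) :
    ∃ B : Finset V, B ⊆ S ∧ u ∈ B ∧ v ∉ B ∧ ∃ w ∈ B, ∃ T₁ T₂, IsTr B T₁ ∧ IsTr (S \ B) T₂ ∧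
      T₁ ⊔ T₂ ⊔ SimpleGraph.edge v w = T := by
  set H := rst T {v}ᶜ with hH
  set B : Finset V := Finset.univ.filter (fun a => H.Reachable u a) with hB
  have mB : ∀ a, a ∈ B ↔ H.Reachable u a := by intro a; simp [hB]
  have huB : u ∈ B := by rw [mB]
  have hvB : v ∉ B := by
    rw [mB]
    intro h
    exact closed_reach (G := H) (X := {v}ᶜ) (fun a b _ hab => hab.2.2) huv h rfl
  have hBcl : ∀ a b, a ∈ B → T.Adj a b → b ∈ B ∨ b = v := by
    intro a b ha hab
    by_cases hb : b = v
    · exact Or.inr hb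
    · left
      rw [mB] at ha ⊢
      refine ha.trans (SimpleGraph.Adj.reachable ⟨hab, ?_, hb⟩)
      intro h
      rw [Set.mem_singleton_iff] at h
      subst h
      exact hvB ((mB _).2 ha)
  have hBS : B ⊆ S := by
    intro a ha
    rw [mB] at ha
    exact closed_reach (G := H) (X := (S : Set V)) (fun a b _ hab => hT.2.1 _ _ hab.1.symm) hu ha
  obtain ⟨w, hw, hvw⟩ : ∃ w ∈ B, T.Adj v w := by
    by_contra hcon
    push Not at hcon
    refine hvB (closed_reach (G := T) (X := (B : Set V)) ?_ huB (hT.2.2 u hu v hv))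
    intro a b ha hab
    rcases hBcl a b ha hab with h | h
    · exact h
    · subst h
      exact absurd hab.symm (hcon a ha)
  have huniq : ∀ a ∈ B, T.Adj v a → a = w := by
    intro a ha hva
    by_contra haw
    have := SimpleGraph.isAcyclic_iff_forall_adj_isBridge.1 hT.1 hva
    rw [SimpleGraph.isBridge_iff] at this
    apply this
    have hle : H ≤ T.deleteEdges {s(v, a)} := by
      intro c d hcd
      rw [SimpleGraph.deleteEdges_adj]
      refine ⟨hcd.1, ?_⟩
      have h1 := hcd.2.1
      have h2 := hcd.2.2
      simp only [Set.mem_compl_iff, Set.mem_singleton_iff] at h1 h2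
      simp only [Set.mem_singleton_iff, Sym2.eq_iff]
      tauto
    have r1 : (T.deleteEdges {s(v, a)}).Adj v w := by
      rw [SimpleGraph.deleteEdges_adj]
      refine ⟨hvw, ?_⟩
      simp only [Set.mem_singleton_iff, Sym2.eq_iff]
      rintro (h | h)
      · exact haw h.2.symm
      · exact hvB (h.1 ▸ ha)
    have r2 : H.Reachable w a := ((mB w).1 hw).symm.trans ((mB a).1 ha)
    exact r1.reachable.trans (r2.mono hle)
  refine ⟨B, hBS, huB, hvB, w, hw, rst T B, rst T (B : Set V)ᶜ, ⟨hT.1.anti (rst_le _ _), ?_, ?_⟩,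
    ⟨hT.1.anti (rst_le _ _), ?_, ?_⟩, ?_⟩
  · intro a b h; exact h.2.1
  · have key : ∀ a ∈ B, (rst T B).Reachable u a := by
      intro a ha
      refine reach_rst (G := H) (X := (B : Set V)) ?_ huB ((mB a).1 ha)
      intro c d hc hcd
      have hd : d ∈ B := by
        rcases hBcl c d hc hcd.1 with h | h
        · exact h
        · exact absurd h hcd.2.2
      exact ⟨hd, hcd.1, hc, hd⟩
    intro a ha b hb
    exact (key a ha).symm.trans (key b hb)
  · intro a b h
    exact Finset.mem_sdiff.2 ⟨hT.2.1 _ _ h.1, h.2.1⟩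
  · have key : ∀ a ∈ S \ B, (rst T (B : Set V)ᶜ).Reachable v a := by
      intro a ha
      rw [Finset.mem_sdiff] at ha
      have := closed_reach (G := T)
        (X := {c | c ∈ B ∨ (c ∉ B ∧ (rst T (B : Set V)ᶜ).Reachable v c)}) ?_
        (Or.inr ⟨hvB, .rfl⟩) (hT.2.2 v hv a ha.1)
      · rcases this with h | h
        · exact absurd h ha.2
        · exact h.2
      · rintro c d (hc | hc) hcd
        · rcases hBcl c d hc hcd with h | h
          · exact Or.inl h
          · subst h
            exact Or.inr ⟨hvB, .rfl⟩
        · by_cases hd : d ∈ B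
          · exact Or.inl hd
          · exact Or.inr ⟨hd, hc.2.trans (SimpleGraph.Adj.reachable ⟨hcd, hc.1, hd⟩)⟩
    intro a ha b hb
    exact (key a ha).symm.trans (key b hb)
  · ext a b
    simp only [rst_adj, SimpleGraph.sup_adj, SimpleGraph.edge_adj]
    constructor
    · rintro ((h | h) | h)
      · exact h.1
      · exact h.1
      · rcases h.1 with h | h
        · rw [h.1, h.2]; exact hvw
        · rw [h.1, h.2]; exact hvw.symm
    · intro hab
      by_cases ha : a ∈ B <;> by_cases hb : b ∈ B
      · exact Or.inl (Or.inl ⟨hab, ha, hb⟩)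
      · rcases hBcl a b ha hab with h | h
        · exact absurd h hb
        · subst h
          exact Or.inr ⟨Or.inr ⟨huniq a ha hab.symm, rfl⟩, hab.ne⟩
      · rcases hBcl b a hb hab.symm with h | h
        · exact absurd h ha
        · subst h
          exact Or.inr ⟨Or.inl ⟨rfl, huniq b hb hab⟩, hab.ne⟩
      · exact Or.inl (Or.inr ⟨hab, ha, hb⟩)

/-- weighted number of trees on `S` -/
def trS (x : ℝ) (S : Finset V) : ℝ := ∑ T ∈ Finset.univ.filter (IsTr S), x ^ eN T

/-- weighted number of forests on `S` -/
def foS (x : ℝ) (K : ℕ) (S : Finset V) : ℝ := ∑ T ∈ Finset.univ.filter (IsFo K S), x ^ eN T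

lemma trS_rec (x : ℝ) {S : Finset V} {u v : V} (hu : u ∈ S) (hv : v ∈ S) (huv : u ≠ v) :
    trS x S = ∑ A ∈ (S \ {u, v}).powerset,
      ((A.card : ℝ) + 1) * x * trS x (insert u A) * trS x (S \ insert u A) := by
  have h1 : ∀ A ∈ (S \ {u, v}).powerset,
      ((A.card : ℝ) + 1) * x * trS x (insert u A) * trS x (S \ insert u A) =
      ∑ w ∈ insert u A, ∑ T₁ ∈ Finset.univ.filter (IsTr (insert u A)),
        ∑ T₂ ∈ Finset.univ.filter (IsTr (S \ insert u A)), x ^ (eN T₁ + eN T₂ + 1) := by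
    intro A hA
    have huA : u ∉ A := by
      intro h
      have := (Finset.mem_powerset.1 hA) h
      simp at this
    rw [Finset.sum_const, Finset.card_insert_of_notMem huA]
    unfold trS
    rw [nsmul_eq_mul, mul_assoc, Finset.sum_mul_sum, mul_assoc, Finset.mul_sum]
    push_cast
    congr 1
    refine Finset.sum_congr rfl fun _ _ => ?_
    rw [Finset.mul_sum]
    refine Finset.sum_congr rfl fun _ _ => ?_
    ring
  rw [Finset.sum_congr rfl h1]
  simp_rw [Finset.sum_sigma']
  symm
  unfold trS
  have hA : ∀ A : Finset V, A ⊆ S \ {u, v} → insert u A ⊆ S ∧ v ∉ insert u A ∧ u ∉ A := by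
    intro A hA
    refine ⟨?_, ?_, ?_⟩
    · intro a ha
      rw [Finset.mem_insert] at ha
      rcases ha with h | h
      · rw [h]; exact hu
      · exact (Finset.mem_sdiff.1 (hA h)).1
    · intro h
      rw [Finset.mem_insert] at h
      rcases h with h | h
      · exact huv h.symm
      · have := hA h
        simp at this
    · intro h
      have := hA h
      simp at this
  refine Finset.sum_bij (fun i _ => i.2.2.1 ⊔ i.2.2.2 ⊔ SimpleGraph.edge v i.2.1) ?_ ?_ ?_ ?_
  · rintro ⟨A, w, T₁, T₂⟩ h
    simp only [Finset.mem_sigma, Finset.mem_powerset, Finset.mem_filter, Finset.mem_univ,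
      true_and] at h ⊢
    obtain ⟨h1, h2, h3, h4⟩ := h
    exact (glue_tr (hA A h1).1 hv (hA A h1).2.1 h2 h3 h4).1
  · rintro ⟨A, w, T₁, T₂⟩ h ⟨A', w', T₁', T₂'⟩ h' he
    simp only [Finset.mem_sigma, Finset.mem_powerset, Finset.mem_filter, Finset.mem_univ,
      true_and] at h h' he
    obtain ⟨h1, h2, h3, h4⟩ := h
    obtain ⟨h1', h2', h3', h4'⟩ := h'
    have hBB : insert u A = insert u A' := by
      apply Finset.Subset.antisymm
      · exact glue_inj_sub (hA A' h1').2.1 (hA A h1).2.1 (Finset.mem_insert_self _ _)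
          (Finset.mem_insert_self _ _) h3' h4' h3 he.symm
      · exact glue_inj_sub (hA A h1).2.1 (hA A' h1').2.1 (Finset.mem_insert_self _ _)
          (Finset.mem_insert_self _ _) h3 h4 h3' he
    have hAA : A = A' := by
      have := congrArg (fun X => X.erase u) hBB
      simpa [Finset.erase_insert (hA A h1).2.2, Finset.erase_insert (hA A' h1').2.2] using this
    subst hAA
    have hww : w' = w := glue_inj_w (hA A h1).2.1 h2' h3 h4 he
    subst hww
    have r := glue_rst (hA A h1).2.1 h2 h3 h4
    have r' := glue_rst (hA A h1).2.1 h2 h3' h4'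
    have e1 : T₁ = T₁' := by rw [← r.1, ← r'.1, he]
    have e2 : T₂ = T₂' := by rw [← r.2, ← r'.2, he]
    rw [e1, e2]
  · intro T hT
    simp only [Finset.mem_filter, Finset.mem_univ, true_and] at hT
    obtain ⟨B, hBS, huB, hvB, w, hw, T₁, T₂, h₁, h₂, he⟩ := glue_surj hu hv huv hT
    refine ⟨⟨B.erase u, w, T₁, T₂⟩, ?_, he⟩
    simp only [Finset.mem_sigma, Finset.mem_powerset, Finset.mem_filter, Finset.mem_univ,
      true_and, Finset.insert_erase huB]
    refine ⟨?_, hw, h₁, h₂⟩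
    intro a ha
    rw [Finset.mem_erase] at ha
    simp only [Finset.mem_sdiff, Finset.mem_insert, Finset.mem_singleton]
    refine ⟨hBS ha.2, ?_⟩
    rintro (h | h)
    · exact ha.1 h
    · exact hvB (h ▸ ha.2)
  · rintro ⟨A, w, T₁, T₂⟩ h
    simp only [Finset.mem_sigma, Finset.mem_powerset, Finset.mem_filter, Finset.mem_univ,
      true_and] at h ⊢
    obtain ⟨h1, h2, h3, h4⟩ := h
    rw [(glue_tr (hA A h1).1 hv (hA A h1).2.1 h2 h3 h4).2]

lemma foS_rec (x : ℝ) (K : ℕ) {S : Finset V} {v : V} (hv : v ∈ S) :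
    foS x K S = ∑ A ∈ (S \ {v}).powerset,
      if A.card + 1 ≤ K then trS x (insert v A) * foS x K (S \ insert v A) else 0 := by
  rw [← Finset.sum_filter]
  have h1 : ∀ A ∈ (S \ {v}).powerset.filter (fun A => A.card + 1 ≤ K),
      trS x (insert v A) * foS x K (S \ insert v A) =
      ∑ T₁ ∈ Finset.univ.filter (IsTr (insert v A)),
        ∑ T₂ ∈ Finset.univ.filter (IsFo K (S \ insert v A)), x ^ (eN T₁ + eN T₂) := by
    intro A hA
    unfold trS foS
    rw [Finset.sum_mul_sum]
    refine Finset.sum_congr rfl fun _ _ => ?_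
    refine Finset.sum_congr rfl fun _ _ => ?_
    ring
  rw [Finset.sum_congr rfl h1]
  simp_rw [Finset.sum_sigma']
  symm
  unfold foS
  have hA : ∀ A : Finset V, A ⊆ S \ {v} → insert v A ⊆ S ∧ v ∉ A := by
    intro A hA
    refine ⟨?_, ?_⟩
    · intro a ha
      rw [Finset.mem_insert] at ha
      rcases ha with h | h
      · rw [h]; exact hv
      · exact (Finset.mem_sdiff.1 (hA h)).1
    · intro h
      have := hA h
      simp at this
  -- the component of `v` in the glued graph
  have comp : ∀ (B : Finset V) (T₁ T₂ : SimpleGraph V), v ∈ B → IsTr B T₁ →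
      IsFo K (S \ B) T₂ → ∀ b ∈ B, {c | (T₁ ⊔ T₂).Reachable b c} = (B : Set V) := by
    intro B T₁ T₂ hvB h₁ h₂ b hb
    ext c
    constructor
    · intro hc
      refine closed_reach (G := T₁ ⊔ T₂) (X := (B : Set V)) ?_ hb hc
      rintro a d ha (had | had)
      · exact h₁.2.1 _ _ had.symm
      · exact absurd ha (Finset.mem_sdiff.1 (h₂.2.1 _ _ had)).2
    · intro hc
      exact (h₁.2.2 b hb c hc).mono le_sup_left
  have rs : ∀ (B : Finset V) (T₁ T₂ : SimpleGraph V), IsTr B T₁ →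
      IsFo K (S \ B) T₂ → rst (T₁ ⊔ T₂) B = T₁ ∧ rst (T₁ ⊔ T₂) (B : Set V)ᶜ = T₂ := by
    intro B T₁ T₂ h₁ h₂
    constructor
    · ext a b
      simp only [rst_adj, SimpleGraph.sup_adj]
      constructor
      · rintro ⟨h | h, ha, hb⟩
        · exact h
        · exact absurd ha (Finset.mem_sdiff.1 (h₂.2.1 _ _ h)).2
      · intro h
        exact ⟨Or.inl h, h₁.2.1 _ _ h, h₁.2.1 _ _ h.symm⟩
    · ext a b
      simp only [rst_adj, SimpleGraph.sup_adj]
      constructor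
      · rintro ⟨h | h, ha, hb⟩
        · exact absurd (h₁.2.1 _ _ h) ha
        · exact h
      · intro h
        exact ⟨Or.inr h, (Finset.mem_sdiff.1 (h₂.2.1 _ _ h)).2,
          (Finset.mem_sdiff.1 (h₂.2.1 _ _ h.symm)).2⟩
  refine Finset.sum_bij (fun i _ => i.2.1 ⊔ i.2.2) ?_ ?_ ?_ ?_
  · rintro ⟨A, T₁, T₂⟩ h
    simp only [Finset.mem_sigma, Finset.mem_powerset, Finset.mem_filter, Finset.mem_univ,
      true_and] at h ⊢
    obtain ⟨⟨h1, hK⟩, h3, h4⟩ := h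
    have e2 : ∀ a b, T₂.Adj a b → a ∉ ((insert v A : Finset V) : Set V) := fun a b h =>
      (Finset.mem_sdiff.1 (h4.2.1 a b h)).2
    refine ⟨acyclic_disj (B := ((insert v A : Finset V) : Set V)) h3.1 h4.1 h3.2.1 e2, ?_, ?_⟩
    · rintro a b (h | h)
      · exact (hA A h1).1 (h3.2.1 _ _ h)
      · exact (Finset.mem_sdiff.1 (h4.2.1 _ _ h)).1
    · intro a ha
      by_cases haB : a ∈ insert v A
      · rw [comp _ T₁ T₂ (Finset.mem_insert_self v A) h3 h4 a haB, Set.ncard_coe_finset,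
          Finset.card_insert_of_notMem (hA A h1).2]
        exact hK
      · refine le_trans (Set.ncard_le_ncard ?_ (Set.toFinite _)) (h4.2.2 a (by simp [ha] at haB ⊢; exact haB))
        intro c hc
        refine reach_rst (G := T₁ ⊔ T₂) (X := ((insert v A : Finset V) : Set V)ᶜ) ?_ haB hc
        rintro c d hc (h | h)
        · exact absurd (h3.2.1 _ _ h) hc
        · exact ⟨e2 _ _ h.symm, h⟩
  · rintro ⟨A, T₁, T₂⟩ h ⟨A', T₁', T₂'⟩ h' he
    simp only [Finset.mem_sigma, Finset.mem_powerset, Finset.mem_filter, Finset.mem_univ,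
      true_and] at h h' he
    obtain ⟨⟨h1, hK⟩, h3, h4⟩ := h
    obtain ⟨⟨h1', hK'⟩, h3', h4'⟩ := h'
    have hBB : insert v A = insert v A' := by
      have c1 := comp _ T₁ T₂ (Finset.mem_insert_self v A) h3 h4 v (Finset.mem_insert_self v A)
      have c2 := comp _ T₁' T₂' (Finset.mem_insert_self v A') h3' h4' v
        (Finset.mem_insert_self v A')
      rw [he, c2] at c1
      exact (Finset.coe_injective c1).symm
    have hAA : A = A' := by
      have := congrArg (fun X => X.erase v) hBB
      simpa [Finset.erase_insert (hA A h1).2, Finset.erase_insert (hA A' h1').2] using this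
    subst hAA
    have r := rs _ T₁ T₂ h3 h4
    have r' := rs _ T₁' T₂' h3' h4'
    have e1 : T₁ = T₁' := by rw [← r.1, ← r'.1, he]
    have e2 : T₂ = T₂' := by rw [← r.2, ← r'.2, he]
    rw [e1, e2]
  · intro T hT
    simp only [Finset.mem_filter, Finset.mem_univ, true_and] at hT
    set B : Finset V := Finset.univ.filter (fun a => T.Reachable v a) with hB
    have mB : ∀ a, a ∈ B ↔ T.Reachable v a := by intro a; simp [hB]
    have hvB : v ∈ B := by rw [mB]
    have hcl : ∀ a b, T.Adj a b → (a ∈ B ↔ b ∈ B) := by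
      intro a b hab
      rw [mB, mB]
      exact ⟨fun h => h.trans hab.reachable, fun h => h.trans hab.symm.reachable⟩
    have hBS : B ⊆ S := by
      intro a ha
      rw [mB] at ha
      exact closed_reach (G := T) (X := (S : Set V)) (fun a b _ hab => hT.2.1 _ _ hab.symm) hv ha
    refine ⟨⟨B.erase v, rst T B, rst T (B : Set V)ᶜ⟩, ?_, ?_⟩
    · simp only [Finset.mem_sigma, Finset.mem_powerset, Finset.mem_filter, Finset.mem_univ,
        true_and, Finset.insert_erase hvB]
      refine ⟨⟨?_, ?_⟩, ⟨hT.1.anti (rst_le _ _), ?_, ?_⟩, ⟨hT.1.anti (rst_le _ _), ?_, ?_⟩⟩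
      · intro a ha
        rw [Finset.mem_erase] at ha
        simp only [Finset.mem_sdiff, Finset.mem_singleton]
        exact ⟨hBS ha.2, ha.1⟩
      · rw [Finset.card_erase_add_one hvB, ← Set.ncard_coe_finset]
        convert hT.2.2 v hv using 2
        ext a; exact mB a
      · intro a b h; exact h.2.1
      · have key : ∀ a ∈ B, (rst T B).Reachable v a := by
          intro a ha
          refine reach_rst (G := T) (X := (B : Set V)) ?_ hvB ((mB a).1 ha)
          intro c d hc hcd
          exact ⟨(hcl c d hcd).1 hc, hcd, hc, (hcl c d hcd).1 hc⟩
        intro a ha b hb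
        exact (key a ha).symm.trans (key b hb)
      · intro a b h
        exact Finset.mem_sdiff.2 ⟨hT.2.1 _ _ h.1, h.2.1⟩
      · intro a ha
        refine le_trans (Set.ncard_le_ncard ?_ (Set.toFinite _))
          (hT.2.2 a (Finset.mem_sdiff.1 ha).1)
        intro c hc
        exact SimpleGraph.Reachable.mono (rst_le _ _) hc
    · ext a b
      simp only [rst_adj, SimpleGraph.sup_adj]
      constructor
      · rintro (h | h)
        · exact h.1
        · exact h.1
      · intro hab
        by_cases ha : a ∈ B
        · exact Or.inl ⟨hab, ha, (hcl a b hab).1 ha⟩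
        · exact Or.inr ⟨hab, ha, fun h => ha ((hcl a b hab).2 h)⟩
  · rintro ⟨A, T₁, T₂⟩ h
    simp only [Finset.mem_sigma, Finset.mem_powerset, Finset.mem_filter, Finset.mem_univ,
      true_and] at h ⊢
    obtain ⟨⟨h1, hK⟩, h3, h4⟩ := h
    rw [eN_disj (B := ((insert v A : Finset V) : Set V)) h3.2.1]
    exact fun a b h => (Finset.mem_sdiff.1 (h4.2.1 a b h)).2

end Combi

/-- Sequence of moments attached to cumulants `c`. -/
def Aseq (c : ℕ → ℝ) : ℕ → ℝ
  | 0 => 1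
  | n + 1 => ∑ j : Fin (n + 1), (n.choose j : ℝ) * c (j + 1) * Aseq c (n - j)

/-- `Rseq n` is the number of trees on `n+1` vertices. -/
def Rseq : ℕ → ℝ
  | 0 => 1
  | n + 1 => ∑ j : Fin (n + 1), (n.choose j : ℝ) * ((j : ℕ) + 1) * Rseq j * Rseq (n - j)

lemma Aseq_zero (c : ℕ → ℝ) : Aseq c 0 = 1 := by rw [Aseq]

lemma Aseq_succ (c : ℕ → ℝ) (n : ℕ) : Aseq c (n + 1) =
    ∑ j ∈ Finset.range (n + 1), (n.choose j : ℝ) * c (j + 1) * Aseq c (n - j) := by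
  rw [Aseq, Finset.sum_range]

lemma Rseq_zero : Rseq 0 = 1 := by rw [Rseq]

lemma Rseq_succ (n : ℕ) : Rseq (n + 1) =
    ∑ j ∈ Finset.range (n + 1), (n.choose j : ℝ) * ((j : ℝ) + 1) * Rseq j * Rseq (n - j) := by
  rw [Rseq, Finset.sum_range]

/-- cumulants of the forest measure with component size at most `K` -/
def cF (x : ℝ) (K k : ℕ) : ℝ := if k ≤ K then x ^ (k - 1) * Rseq (k - 1) else 0

section Combi2
open Classical
variable {V : Type*} [Fintype V]

lemma powsum (f : ℕ → ℝ) (s : Finset V) : ∑ A ∈ s.powerset, f A.card =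
    ∑ j ∈ Finset.range (s.card + 1), (s.card.choose j : ℝ) * f j := by
  rw [Finset.sum_powerset_apply_card f]
  simp only [nsmul_eq_mul]

lemma eN_bot : eN (⊥ : SimpleGraph V) = 0 := by simp [eN]

lemma trS_singleton (x : ℝ) (v : V) : trS x ({v} : Finset V) = 1 := by
  have : Finset.univ.filter (IsTr ({v} : Finset V)) = {⊥} := by
    ext T
    simp only [Finset.mem_filter, Finset.mem_univ, true_and, Finset.mem_singleton]
    constructor
    · rintro ⟨-, h, -⟩
      ext a b
      simp only [SimpleGraph.bot_adj, iff_false]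
      intro hab
      have h1 := h _ _ hab
      have h2 := h _ _ hab.symm
      rw [Finset.mem_singleton] at h1 h2
      exact hab.ne (h1.trans h2.symm)
    · rintro rfl
      refine ⟨SimpleGraph.isAcyclic_bot, by simp, ?_⟩
      intro a ha b hb
      rw [Finset.mem_singleton] at ha hb
      rw [ha, hb]
  rw [trS, this]
  simp [eN_bot]

lemma foS_empty (x : ℝ) (K : ℕ) : foS x K (∅ : Finset V) = 1 := by
  have : Finset.univ.filter (IsFo K (∅ : Finset V)) = {⊥} := by
    ext T
    simp only [Finset.mem_filter, Finset.mem_univ, true_and, Finset.mem_singleton]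
    constructor
    · rintro ⟨-, h, -⟩
      ext a b
      simp only [SimpleGraph.bot_adj, iff_false]
      intro hab
      have h1 := h _ _ hab
      simp at h1
    · rintro rfl
      refine ⟨SimpleGraph.isAcyclic_bot, by simp, by simp⟩
  rw [foS, this]
  simp [eN_bot]

lemma trS_eq (x : ℝ) (n : ℕ) : ∀ S : Finset V, S.card = n + 1 → trS x S = x ^ n * Rseq n := by
  induction n using Nat.strong_induction_on with
  | _ n ih =>
  intro S hS
  rcases n with _ | n
  · obtain ⟨v, rfl⟩ := Finset.card_eq_one.1 hS
    rw [trS_singleton, Rseq_zero]; simp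
  · obtain ⟨u, hu, v, hv, huv⟩ := Finset.one_lt_card.1 (by omega : 1 < S.card)
    rw [trS_rec x hu hv huv]
    have hc : (S \ {u, v}).card = n := by
      rw [Finset.card_sdiff_of_subset (by intro a; simp; rintro (h | h) <;> simpa [h])]
      rw [Finset.card_pair huv]; omega
    have : ∀ A ∈ (S \ {u, v}).powerset,
        ((A.card : ℝ) + 1) * x * trS x (insert u A) * trS x (S \ insert u A) =
        (fun j : ℕ => ((j : ℝ) + 1) * x * (x ^ j * Rseq j) * (x ^ (n - j) * Rseq (n - j))) A.card := by
      intro A hA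
      rw [Finset.mem_powerset] at hA
      have huA : u ∉ A := by
        intro h
        have := hA h
        simp at this
      have hle : A.card ≤ n := hc ▸ Finset.card_le_card hA
      have hins : insert u A ⊆ S := by
        intro a ha
        rw [Finset.mem_insert] at ha
        rcases ha with h | h
        · rw [h]; exact hu
        · exact (Finset.mem_sdiff.1 (hA h)).1
      rw [ih A.card (by omega) _ (Finset.card_insert_of_notMem huA)]
      rw [ih (n - A.card) (by omega) _ (by
        rw [Finset.card_sdiff_of_subset hins, Finset.card_insert_of_notMem huA]; omega)]
    refine (Finset.sum_congr rfl this).trans ?_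
    rw [powsum (fun j : ℕ => ((j : ℝ) + 1) * x * (x ^ j * Rseq j) * (x ^ (n - j) * Rseq (n - j)))
      (S \ {u, v})]
    rw [hc, Rseq_succ, Finset.mul_sum]
    refine Finset.sum_congr rfl fun j hj => ?_
    have hj' : j ≤ n := by simpa [Nat.lt_succ_iff] using hj
    have : x ^ (n + 1) = x * x ^ j * x ^ (n - j) := by
      rw [mul_assoc, ← pow_add, Nat.add_sub_cancel' hj']; ring
    rw [this]
    ring

lemma foS_eq (x : ℝ) (K n : ℕ) : ∀ S : Finset V, S.card = n → foS x K S = Aseq (cF x K) n := by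
  induction n using Nat.strong_induction_on with
  | _ n ih =>
  intro S hS
  rcases n with _ | n
  · rw [Finset.card_eq_zero] at hS
    rw [hS, foS_empty, Aseq_zero]
  · obtain ⟨v, hv⟩ := Finset.card_pos.1 (by omega : 0 < S.card)
    rw [foS_rec x K hv]
    have hc : (S \ {v}).card = n := by
      rw [Finset.card_sdiff_of_subset (by simpa using hv)]
      simp; omega
    have : ∀ A ∈ (S \ {v}).powerset,
        (if A.card + 1 ≤ K then trS x (insert v A) * foS x K (S \ insert v A) else 0) =
        (fun j : ℕ => cF x K (j + 1) * Aseq (cF x K) (n - j)) A.card := by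
      intro A hA
      rw [Finset.mem_powerset] at hA
      have huA : v ∉ A := by
        intro h
        have := hA h
        simp at this
      have hle : A.card ≤ n := hc ▸ Finset.card_le_card hA
      have hins : insert v A ⊆ S := by
        intro a ha
        rw [Finset.mem_insert] at ha
        rcases ha with h | h
        · rw [h]; exact hv
        · exact (Finset.mem_sdiff.1 (hA h)).1
      rw [trS_eq x A.card _ (Finset.card_insert_of_notMem huA)]
      rw [ih (n - A.card) (by omega) _ (by
        rw [Finset.card_sdiff_of_subset hins, Finset.card_insert_of_notMem huA]; omega)]
      simp only [cF]
      split_ifs <;> simp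
    refine (Finset.sum_congr rfl this).trans ?_
    rw [powsum (fun j : ℕ => cF x K (j + 1) * Aseq (cF x K) (n - j)) (S \ {v})]
    rw [hc, Aseq_succ]
    refine Finset.sum_congr rfl fun j hj => ?_
    ring

lemma acyclic_count {G : SimpleGraph V} (hG : G.IsAcyclic) :
    eN G + Nat.card G.ConnectedComponent = Fintype.card V := by
  have h1 : ∑ v, G.degree v = 2 * eN G := by
    rw [SimpleGraph.sum_degrees_eq_twice_card_edges, eN, Set.ncard_eq_toFinset_card',
      SimpleGraph.edgeFinset]
  have h2 : ∀ c : G.ConnectedComponent,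
      (∑ v ∈ Finset.univ.filter (fun v => G.connectedComponentMk v = c), G.degree v) + 2 =
      ∑ v ∈ Finset.univ.filter (fun v => G.connectedComponentMk v = c), 2 := by
    intro c
    have ht := hG.isTree_connectedComponent c
    have hcard := ht.card_edgeFinset
    have hdeg := c.toSimpleGraph.sum_degrees_eq_twice_card_edges
    have hd : ∀ v : c, c.toSimpleGraph.degree v = G.degree v.1 := by
      intro v
      rw [← SimpleGraph.card_neighborFinset_eq_degree, ← SimpleGraph.card_neighborFinset_eq_degree]
      refine Finset.card_bij (fun a _ => a.1) ?_ ?_ ?_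
      · intro a ha
        rw [SimpleGraph.mem_neighborFinset] at ha ⊢
        exact ha
      · intro a _ b _ h
        exact Subtype.ext h
      · intro b hb
        rw [SimpleGraph.mem_neighborFinset] at hb
        have hbc : b ∈ c := by
          have h1 : G.connectedComponentMk v.1 = c := v.2
          have h2 : G.connectedComponentMk b = G.connectedComponentMk v.1 :=
            SimpleGraph.ConnectedComponent.sound hb.symm.reachable
          exact h2.trans h1
        exact ⟨⟨b, hbc⟩, by rw [SimpleGraph.mem_neighborFinset]; exact hb, rfl⟩
    have hs : ∀ f : V → ℕ, ∑ v ∈ Finset.univ.filter (fun v => G.connectedComponentMk v = c), f v =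
        ∑ v : c, f v.1 := by
      intro f
      refine Finset.sum_subtype (F := inferInstance) _ ?_ f
      intro v
      simp only [Finset.mem_filter, Finset.mem_univ, true_and]
      exact Iff.rfl
    rw [hs, hs, Finset.sum_const, Finset.card_univ, ← hcard, smul_eq_mul]
    simp_rw [hd] at hdeg
    rw [hdeg]
    ring
  have h3 := Finset.sum_congr (rfl : (Finset.univ : Finset G.ConnectedComponent) = Finset.univ)
    (fun c _ => h2 c)
  have hf : ∀ f : V → ℕ, ∑ c : G.ConnectedComponent,
      ∑ v ∈ Finset.univ.filter (fun v => G.connectedComponentMk v = c), f v = ∑ v, f v := by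
    intro f
    convert Finset.sum_fiberwise (Finset.univ : Finset V) G.connectedComponentMk f
  rw [Finset.sum_add_distrib, hf, hf, h1] at h3
  simp only [Finset.sum_const, smul_eq_mul, Finset.card_univ] at h3
  rw [Nat.card_eq_fintype_card]
  omega

end Combi2

/-! ### Exponential formula -/

section ExpF
open Nat

lemma expF_iter (c : ℕ → ℝ) (K : ℕ) (hc : ∀ k, K < k → c k = 0) (n : ℕ) :
    iteratedDeriv n (fun z : ℂ => Complex.exp
      (∑ k ∈ Finset.range K, (c (k + 1) : ℂ) / ((k + 1)! : ℂ) * z ^ (k + 1))) 0 = (Aseq c n : ℂ) := by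
  set W' : ℂ → ℂ := fun z => ∑ k ∈ Finset.range K, (c (k + 1) : ℂ) / (k ! : ℂ) * z ^ k with hW'
  have hW : ∀ z : ℂ, HasDerivAt (fun z : ℂ => 
      (∑ k ∈ Finset.range K, (c (k + 1) : ℂ) / ((k + 1)! : ℂ) * z ^ (k + 1))) (W' z) z := by
    intro z
    refine HasDerivAt.fun_sum fun k hk => ?_
    have := (hasDerivAt_pow (k + 1) z).const_mul ((c (k + 1) : ℂ) / ((k + 1)! : ℂ))
    refine this.congr_deriv ?_
    have h1 : (k ! : ℂ) ≠ 0 := by exact_mod_cast (Nat.factorial_pos k).ne'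
    have h2 : ((k : ℂ) + 1) ≠ 0 := by exact_mod_cast Nat.succ_ne_zero k
    rw [Nat.factorial_succ]
    push_cast
    field_simp
  set g : ℂ → ℂ := fun z : ℂ => Complex.exp
      (∑ k ∈ Finset.range K, (c (k + 1) : ℂ) / ((k + 1)! : ℂ) * z ^ (k + 1)) with hg
  have hder : deriv g = fun z => W' z * g z := by
    ext z
    have := (hW z).cexp.deriv
    rw [hg]
    simp only
    rw [this, mul_comm]
  have hgd : ∀ m : ℕ, ContDiffAt ℂ m g 0 := by
    intro m
    refine ContDiff.contDiffAt ?_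
    rw [hg]
    fun_prop
  have hWd : ∀ m : ℕ, ContDiffAt ℂ m W' 0 := by
    intro m
    refine ContDiff.contDiffAt ?_
    rw [hW']
    fun_prop
  have hWi : ∀ i : ℕ, iteratedDeriv i W' 0 = c (i + 1) := by
    intro i
    rw [hW', iteratedDeriv_fun_sum (by intro k hk; fun_prop)]
    simp only [iteratedDeriv_const_mul_field, iteratedDeriv_fun_pow_zero]
    by_cases hi : i < K
    · rw [Finset.sum_eq_single i]
      · have h1 : (i ! : ℂ) ≠ 0 := by exact_mod_cast (Nat.factorial_pos i).ne'
        simp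
        field_simp
      · intro b _ hb
        simp [hb.symm]
      · intro h; exact absurd (Finset.mem_range.2 hi) h
    · rw [hc (i + 1) (by omega)]
      rw [Finset.sum_eq_zero]
      · simp
      intro k hk
      have : i ≠ k := by rintro rfl; exact hi (Finset.mem_range.1 hk)
      simp [this]
  induction n using Nat.strong_induction_on with
  | _ n ih =>
  rcases n with _ | n
  · simp [Aseq_zero, hg]
  · rw [iteratedDeriv_succ', hder]
    have := iteratedDeriv_mul (hWd n) (hgd n)
    have e : (fun z => W' z * g z) = W' * g := rfl
    rw [e, this, Aseq_succ]
    push_cast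
    refine Finset.sum_congr rfl fun i hi => ?_
    rw [hWi, ih (n - i) (by omega)]

lemma expF (c : ℕ → ℝ) (K : ℕ) (hc : ∀ k, K < k → c k = 0) (z : ℝ) :
    HasSum (fun n => Aseq c n * (z ^ n / (n ! : ℝ)))
      (Real.exp (∑ k ∈ Finset.range K, c (k + 1) / ((k + 1)! : ℝ) * z ^ (k + 1))) := by
  have hd : Differentiable ℂ (fun z : ℂ => Complex.exp
      (∑ k ∈ Finset.range K, (c (k + 1) : ℂ) / ((k + 1)! : ℂ) * z ^ (k + 1))) := by fun_prop
  have := Complex.hasSum_taylorSeries_of_entire hd 0 (z : ℂ)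
  simp only [expF_iter c K hc] at this
  rw [← Complex.hasSum_ofReal]
  have e1 : ((Real.exp (∑ k ∈ Finset.range K, c (k + 1) / ((k + 1)! : ℝ) * z ^ (k + 1)) : ℝ) : ℂ) =
    Complex.exp (∑ k ∈ Finset.range K, (c (k + 1) : ℂ) / ((k + 1)! : ℂ) * (z : ℂ) ^ (k + 1)) := by
    push_cast
    rfl
  rw [e1]
  refine this.congr_fun ?_
  intro n
  push_cast
  simp only [smul_eq_mul, sub_zero]
  ring

end ExpF

/-! ### The tree function -/

section TreeF
open Nat

/-- truncated tree function -/
def Tk (K : ℕ) (w : ℝ) : ℝ := ∑ n ∈ Finset.range K, Rseq n / (n ! : ℝ) * w ^ (n + 1)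

/-- truncated unrooted tree function -/
def Uk (K : ℕ) (w : ℝ) : ℝ := ∑ n ∈ Finset.range K, Rseq n / ((n + 1)! : ℝ) * w ^ (n + 1)

lemma Rseq_pos (n : ℕ) : 0 < Rseq n := by
  induction n using Nat.strong_induction_on with
  | _ n ih =>
  rcases n with _ | n
  · rw [Rseq_zero]; norm_num
  · rw [Rseq_succ]
    refine Finset.sum_pos (fun j hj => ?_) ⟨0, by simp⟩
    have hj' : j ≤ n := by simpa [Nat.lt_succ_iff] using hj
    have h1 := ih j (by omega)
    have h2 := ih (n - j) (by omega)
    have h3 : 0 < (n.choose j : ℝ) := by exact_mod_cast Nat.choose_pos hj'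
    positivity

/-- truncated rooted cumulants -/
def cR (K k : ℕ) : ℝ := if k ≤ K then (k : ℝ) * Rseq (k - 1) else 0

lemma Aseq_cR_eq (K n : ℕ) (hn : n ≤ K) : Aseq (cR K) n = Rseq n := by
  induction n using Nat.strong_induction_on with
  | _ n ih =>
  rcases n with _ | n
  · rw [Rseq_zero, Aseq_zero]
  · rw [Rseq_succ, Aseq_succ]
    refine Finset.sum_congr rfl fun j hj => ?_
    have hj' : j ≤ n := by simpa [Nat.lt_succ_iff] using hj
    rw [ih (n - j) (by omega) (by omega), cR, if_pos (by omega)]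
    simp only [Nat.add_sub_cancel]
    push_cast
    ring

lemma Aseq_cR_bd (K n : ℕ) : 0 ≤ Aseq (cR K) n ∧ Aseq (cR K) n ≤ Rseq n := by
  induction n using Nat.strong_induction_on with
  | _ n ih =>
  rcases n with _ | n
  · rw [Rseq_zero, Aseq_zero]; norm_num
  · rw [Rseq_succ, Aseq_succ]
    have hc : ∀ j, 0 ≤ cR K (j + 1) ∧ cR K (j + 1) ≤ ((j : ℝ) + 1) * Rseq j := by
      intro j
      have := Rseq_pos j
      rw [cR]
      split_ifs
      · simp only [Nat.add_sub_cancel]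
        push_cast
        constructor
        · positivity
        · exact le_rfl
      · constructor
        · exact le_rfl
        · positivity
    constructor
    · refine Finset.sum_nonneg fun j hj => ?_
      have := (ih (n - j) (by omega)).1
      have := (hc j).1
      positivity
    · refine Finset.sum_le_sum fun j hj => ?_
      have h1 := (ih (n - j) (by omega))
      have h2 := hc j
      have h3 := Rseq_pos j
      rw [mul_assoc (n.choose j : ℝ) ((j : ℝ) + 1)]
      exact mul_le_mul (mul_le_mul_of_nonneg_left h2.2 (by positivity)) h1.2 h1.1 (by positivity)

lemma cR_hasSum (K : ℕ) (z : ℝ) : HasSum (fun n => Aseq (cR K) n * (z ^ n / (n ! : ℝ)))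
    (Real.exp (Tk K z)) := by
  have := expF (cR K) K (fun k hk => by rw [cR, if_neg (by omega)]) z
  convert this using 2
  refine Finset.sum_congr rfl fun j hj => ?_
  have hj' : j < K := by simpa using hj
  rw [cR, if_pos (by omega), Nat.factorial_succ]
  simp only [Nat.add_sub_cancel]
  push_cast
  field_simp

lemma Tk_nonneg (K : ℕ) {w : ℝ} (hw : 0 ≤ w) : 0 ≤ Tk K w :=
  Finset.sum_nonneg fun n _ => by have := Rseq_pos n; positivity

lemma Uk_nonneg (K : ℕ) {w : ℝ} (hw : 0 ≤ w) : 0 ≤ Uk K w :=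
  Finset.sum_nonneg fun n _ => by have := Rseq_pos n; positivity

lemma Tk_mono (K : ℕ) {w w' : ℝ} (hw : 0 ≤ w) (h : w ≤ w') : Tk K w ≤ Tk K w' :=
  Finset.sum_le_sum fun n _ => by
    have := Rseq_pos n
    exact mul_le_mul_of_nonneg_left (pow_le_pow_left₀ hw h _) (by positivity)

lemma Uk_mono (K : ℕ) {w w' : ℝ} (hw : 0 ≤ w) (h : w ≤ w') : Uk K w ≤ Uk K w' :=
  Finset.sum_le_sum fun n _ => by
    have := Rseq_pos n
    exact mul_le_mul_of_nonneg_left (pow_le_pow_left₀ hw h _) (by positivity)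

lemma Tk_succ_le (K : ℕ) {z : ℝ} (hz : 0 ≤ z) : Tk (K + 1) z ≤ z * Real.exp (Tk K z) := by
  have h := (cR_hasSum K z)
  have h1 : ∑ n ∈ Finset.range (K + 1), Aseq (cR K) n * (z ^ n / (n ! : ℝ)) ≤ Real.exp (Tk K z) :=
    sum_le_hasSum _ (fun n _ => by have := (Aseq_cR_bd K n).1; positivity) h
  have h2 : Tk (K + 1) z = z * ∑ n ∈ Finset.range (K + 1), Aseq (cR K) n * (z ^ n / (n ! : ℝ)) := by
    rw [Tk, Finset.mul_sum]
    refine Finset.sum_congr rfl fun n hn => ?_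
    have hn' : n ≤ K := by simpa [Nat.lt_succ_iff] using hn
    rw [Aseq_cR_eq K n hn']
    ring
  rw [h2]
  exact mul_le_mul_of_nonneg_left h1 hz

lemma Tk_le (K : ℕ) {t : ℝ} (ht : 0 ≤ t) : Tk K (t * Real.exp (-t)) ≤ t := by
  induction K with
  | zero => simpa [Tk] using ht
  | succ K ih =>
    have hz : 0 ≤ t * Real.exp (-t) := by positivity
    refine (Tk_succ_le K hz).trans ?_
    calc t * Real.exp (-t) * Real.exp (Tk K (t * Real.exp (-t)))
        ≤ t * Real.exp (-t) * Real.exp t :=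
          mul_le_mul_of_nonneg_left (Real.exp_le_exp.2 ih) hz
      _ = t := by rw [mul_assoc, ← Real.exp_add]; simp

lemma T_lim {w M : ℝ} (hw : 0 < w) (h : ∀ K, Tk K w ≤ M) :
    ∃ T, T ≤ M ∧ 0 < T ∧ Tendsto (fun K => Tk K w) atTop (𝓝 T) ∧ w = T * Real.exp (-T) := by
  have hnn : ∀ n, 0 ≤ Rseq n / (n ! : ℝ) * w ^ (n + 1) := fun n => by
    have := Rseq_pos n; positivity
  have hs : Summable (fun n => Rseq n / (n ! : ℝ) * w ^ (n + 1)) :=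
    summable_of_sum_range_le hnn h
  set T := ∑' n, Rseq n / (n ! : ℝ) * w ^ (n + 1) with hT
  have hlim : Tendsto (fun K => Tk K w) atTop (𝓝 T) := hs.hasSum.tendsto_sum_nat
  have hTM : T ≤ M := le_of_tendsto' hlim h
  have hup : T ≤ w * Real.exp T := by
    have h1 : Tendsto (fun K => Tk (K + 1) w) atTop (𝓝 T) := hlim.comp (tendsto_add_atTop_nat 1)
    have h2 : Tendsto (fun K => w * Real.exp (Tk K w)) atTop (𝓝 (w * Real.exp T)) :=
      ((Real.continuous_exp.tendsto _).comp hlim).const_mul w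
    exact le_of_tendsto_of_tendsto' h1 h2 fun K => Tk_succ_le K hw.le
  have hlo : w * Real.exp T ≤ T := by
    have h2 : Tendsto (fun K => w * Real.exp (Tk K w)) atTop (𝓝 (w * Real.exp T)) :=
      ((Real.continuous_exp.tendsto _).comp hlim).const_mul w
    refine le_of_tendsto' h2 fun K => ?_
    have h3 := (cR_hasSum K w).mul_left w
    refine hasSum_le (fun n => ?_) h3 hs.hasSum
    have := (Aseq_cR_bd K n).2
    calc w * (Aseq (cR K) n * (w ^ n / (n ! : ℝ))) ≤ w * (Rseq n * (w ^ n / (n ! : ℝ))) := by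
          gcongr
      _ = _ := by ring
  have he : w * Real.exp T = T := le_antisymm hlo hup
  refine ⟨T, hTM, ?_, hlim, ?_⟩
  · rw [← he]; positivity
  · calc w = w * Real.exp T * Real.exp (-T) := by rw [mul_assoc, ← Real.exp_add]; simp
      _ = T * Real.exp (-T) := by rw [he]

lemma texp_lt {s t : ℝ} (hs : 0 ≤ s) (hst : s < t) (ht : t ≤ 1) :
    s * Real.exp (-s) < t * Real.exp (-t) := by
  have h1 : -(t - s) + 1 < Real.exp (-(t - s)) := Real.add_one_lt_exp (by linarith)
  have h2 : s ≤ t * (-(t - s) + 1) := by nlinarith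
  have h3 : s < t * Real.exp (-(t - s)) :=
    h2.trans_lt (mul_lt_mul_of_pos_left h1 (by linarith))
  have h4 : t * Real.exp (-t) = t * Real.exp (-(t - s)) * Real.exp (-s) := by
    rw [mul_assoc, ← Real.exp_add]; congr 2; ring
  rw [h4]
  exact mul_lt_mul_of_pos_right h3 (Real.exp_pos _)

lemma texp_le_max (T : ℝ) : T * Real.exp (-T) ≤ Real.exp (-1) := by
  have h1 : (T - 1) + 1 ≤ Real.exp (T - 1) := Real.add_one_le_exp _
  have h4 : Real.exp (-1) = Real.exp (T - 1) * Real.exp (-T) := by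
    rw [← Real.exp_add]; congr 1; ring
  rw [h4]
  exact mul_le_mul_of_nonneg_right (by linarith) (Real.exp_pos _).le

lemma T_lim_eq {t : ℝ} (ht : 0 < t) (ht1 : t ≤ 1) :
    Tendsto (fun K => Tk K (t * Real.exp (-t))) atTop (𝓝 t) := by
  obtain ⟨T, h1, h2, h3, h4⟩ := T_lim (w := t * Real.exp (-t)) (M := t) (by positivity)
    (fun K => Tk_le K ht.le)
  rcases h1.lt_or_eq with h | h
  · exact absurd h4 (texp_lt h2.le h ht1).ne'
  · rwa [h] at h3

/-- normalised truncated tree function -/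
def Hk (K : ℕ) (t : ℝ) : ℝ :=
  Real.exp (-t) * ∑ n ∈ Finset.range K, Rseq n / (n ! : ℝ) * (t * Real.exp (-t)) ^ n

lemma Tk_Hk (K : ℕ) (t : ℝ) : Tk K (t * Real.exp (-t)) = t * Hk K t := by
  rw [Tk, Hk, Finset.mul_sum, Finset.mul_sum]
  refine Finset.sum_congr rfl fun n hn => ?_
  ring

lemma Hk_le (K : ℕ) {t : ℝ} (ht : 0 < t) : Hk K t ≤ 1 := by
  have := Tk_le K ht.le
  rw [Tk_Hk] at this
  nlinarith

lemma Hk_unif {δ : ℝ} (hδ : 0 < δ) : ∀ᶠ K in atTop, ∀ t ∈ Icc (0:ℝ) 1, 1 - δ ≤ Hk K t := by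
  have h : TendstoUniformlyOn Hk (fun _ => 1) atTop (Icc (0:ℝ) 1) := by
    refine Monotone.tendstoUniformlyOn_of_forall_tendsto isCompact_Icc ?_ ?_ continuousOn_const ?_
    · intro K
      unfold Hk
      fun_prop
    · intro t ht
      refine monotone_nat_of_le_succ fun K => ?_
      unfold Hk
      refine mul_le_mul_of_nonneg_left ?_ (Real.exp_pos _).le
      rw [Finset.sum_range_succ]
      have := Rseq_pos K
      have := ht.1
      have : 0 ≤ Rseq K / (K ! : ℝ) * (t * Real.exp (-t)) ^ K := by positivity
      linarith
    · intro t ht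
      rcases ht.1.lt_or_eq with h | h
      · have := (T_lim_eq h ht.2).const_mul t⁻¹
        rw [inv_mul_cancel₀ h.ne'] at this
        refine this.congr fun K => ?_
        rw [Tk_Hk]
        field_simp
      · rw [← h]
        refine tendsto_const_nhds.congr' ?_
        filter_upwards [eventually_ge_atTop 1] with K hK
        obtain ⟨K, rfl⟩ := Nat.exists_eq_add_of_le hK
        rw [Hk, add_comm, Finset.sum_range_succ']
        simp [Rseq_zero]
  rw [Metric.tendstoUniformlyOn_iff] at h
  filter_upwards [h δ hδ] with K hK t ht
  have := hK t ht
  rw [Real.dist_eq, abs_lt] at this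
  linarith

lemma hasDerivAt_Uk (K : ℕ) (w : ℝ) :
    HasDerivAt (Uk K) (∑ n ∈ Finset.range K, Rseq n / (n ! : ℝ) * w ^ n) w := by
  unfold Uk
  refine HasDerivAt.fun_sum fun n hn => ?_
  refine ((hasDerivAt_pow (n + 1) w).const_mul _).congr_deriv ?_
  rw [Nat.factorial_succ]
  push_cast
  field_simp

lemma hasDerivAt_phi (K : ℕ) (t : ℝ) :
    HasDerivAt (fun t => Uk K (t * Real.exp (-t))) (Hk K t * (1 - t)) t := by
  have h1 : HasDerivAt (fun t : ℝ => t * Real.exp (-t)) (Real.exp (-t) * (1 - t)) t := by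
    have := (hasDerivAt_id t).mul ((hasDerivAt_neg t).exp)
    refine this.congr_deriv ?_
    simp
    ring
  refine ((hasDerivAt_Uk K _).comp t h1).congr_deriv ?_
  rw [Hk]
  ring

lemma hasDerivAt_Uexp (K : ℕ) (w s : ℝ) :
    HasDerivAt (fun s => Uk K (w * Real.exp s)) (Tk K (w * Real.exp s)) s := by
  have h1 : HasDerivAt (fun s : ℝ => w * Real.exp s) (w * Real.exp s) s :=
    (Real.hasDerivAt_exp s).const_mul w
  refine ((hasDerivAt_Uk K _).comp s h1).congr_deriv ?_
  rw [Tk, Finset.sum_mul]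
  refine Finset.sum_congr rfl fun n hn => ?_
  ring

lemma Uk_zero (K : ℕ) : Uk K 0 = 0 := by simp [Uk]

lemma Uk_upper (K : ℕ) {t : ℝ} (ht : 0 ≤ t) (ht1 : t ≤ 1) :
    Uk K (t * Real.exp (-t)) ≤ t - t ^ 2 / 2 := by
  have hd : ∀ s : ℝ, HasDerivAt (fun s => s - s ^ 2 / 2 - Uk K (s * Real.exp (-s)))
      (1 - s - Hk K s * (1 - s)) s := by
    intro s
    have := ((hasDerivAt_id s).sub ((hasDerivAt_pow 2 s).div_const 2)).sub (hasDerivAt_phi K s)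
    refine this.congr_deriv ?_
    simp
  have hm : MonotoneOn (fun s => s - s ^ 2 / 2 - Uk K (s * Real.exp (-s))) (Icc 0 1) := by
    refine monotoneOn_of_deriv_nonneg (convex_Icc _ _) (fun s _ => (hd s).continuousAt.continuousWithinAt)
      (fun s _ => (hd s).differentiableAt.differentiableWithinAt) ?_
    intro s hs
    rw [interior_Icc] at hs
    rw [(hd s).deriv]
    have := Hk_le K hs.1
    nlinarith [hs.2]
  have := hm (left_mem_Icc.2 zero_le_one) ⟨ht, ht1⟩ ht
  simp only [zero_mul, Uk_zero] at this
  linarith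

lemma Uk_lower {δ : ℝ} (hδ : 0 < δ) : ∀ᶠ K in atTop, ∀ t ∈ Icc (0:ℝ) 1,
    (1 - δ) * (t - t ^ 2 / 2) ≤ Uk K (t * Real.exp (-t)) := by
  filter_upwards [Hk_unif hδ] with K hK t ht
  have hd : ∀ s : ℝ, HasDerivAt (fun s => Uk K (s * Real.exp (-s)) - (1 - δ) * (s - s ^ 2 / 2))
      (Hk K s * (1 - s) - (1 - δ) * (1 - s)) s := by
    intro s
    have := (hasDerivAt_phi K s).sub (((hasDerivAt_id s).sub ((hasDerivAt_pow 2 s).div_const 2)).const_mul (1 - δ))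
    refine this.congr_deriv ?_
    simp
  have hm : MonotoneOn (fun s => Uk K (s * Real.exp (-s)) - (1 - δ) * (s - s ^ 2 / 2)) (Icc 0 1) := by
    refine monotoneOn_of_deriv_nonneg (convex_Icc _ _) (fun s _ => (hd s).continuousAt.continuousWithinAt)
      (fun s _ => (hd s).differentiableAt.differentiableWithinAt) ?_
    intro s hs
    rw [interior_Icc] at hs
    rw [(hd s).deriv]
    have := hK s ⟨hs.1.le, hs.2.le⟩
    nlinarith [hs.2]
  have := hm (left_mem_Icc.2 zero_le_one) ht ht.1
  simp only [zero_mul, Uk_zero] at this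
  linarith

end TreeF

/-! ### Forest partition functions -/

section ForestF
open Nat

lemma cF_nonneg {x : ℝ} (hx : 0 ≤ x) (K k : ℕ) : 0 ≤ cF x K k := by
  have := Rseq_pos (k - 1)
  rw [cF]
  split_ifs <;> positivity

lemma cF_mono {x y : ℝ} (hx : 0 ≤ x) (hxy : x ≤ y) {K K' : ℕ} (hK : K ≤ K') (k : ℕ) :
    cF x K k ≤ cF y K' k := by
  have h := Rseq_pos (k - 1)
  by_cases hk : k ≤ K
  · rw [cF, cF, if_pos hk, if_pos (hk.trans hK)]
    exact mul_le_mul_of_nonneg_right (pow_le_pow_left₀ hx hxy _) h.le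
  · rw [cF, if_neg hk]
    exact cF_nonneg (hx.trans hxy) _ _

lemma Aseq_nonneg {c : ℕ → ℝ} (hc : ∀ k, 0 ≤ c k) (n : ℕ) : 0 ≤ Aseq c n := by
  induction n using Nat.strong_induction_on with
  | _ n ih =>
  rcases n with _ | n
  · rw [Aseq_zero]; norm_num
  · rw [Aseq_succ]
    refine Finset.sum_nonneg fun j hj => ?_
    have := ih (n - j) (by omega)
    have := hc (j + 1)
    positivity

lemma Aseq_mono {c d : ℕ → ℝ} (hc : ∀ k, 0 ≤ c k) (hcd : ∀ k, c k ≤ d k) (n : ℕ) :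
    Aseq c n ≤ Aseq d n := by
  induction n using Nat.strong_induction_on with
  | _ n ih =>
  rcases n with _ | n
  · rw [Aseq_zero, Aseq_zero]
  · rw [Aseq_succ, Aseq_succ]
    refine Finset.sum_le_sum fun j hj => ?_
    have h1 := ih (n - j) (by omega)
    exact mul_le_mul (mul_le_mul_of_nonneg_left (hcd _) (by positivity)) h1 (Aseq_nonneg hc _)
      (mul_nonneg (by positivity) ((hc _).trans (hcd _)))

lemma Aseq_step {c : ℕ → ℝ} (hc : ∀ k, 0 ≤ c k) (h1 : c 1 = 1) {j n : ℕ} (hjn : j ≤ n) :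
    Aseq c j ≤ Aseq c n := by
  refine monotone_nat_of_le_succ (fun n => ?_) hjn
  rw [Aseq_succ]
  have := Finset.single_le_sum (f := fun j => (n.choose j : ℝ) * c (j + 1) * Aseq c (n - j))
    (s := Finset.range (n + 1)) (fun j _ => mul_nonneg (mul_nonneg (by positivity) (hc _))
      (Aseq_nonneg hc _)) (Finset.mem_range.2 (Nat.succ_pos n))
  simpa [h1] using this

lemma FK_hasSum {x : ℝ} (hx : 0 < x) (K : ℕ) (z : ℝ) :
    HasSum (fun n => Aseq (cF x K) n * (z ^ n / (n ! : ℝ))) (Real.exp (Uk K (x * z) / x)) := by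
  have := expF (cF x K) K (fun k hk => by rw [cF, if_neg (by omega)]) z
  convert this using 2
  rw [Uk, Finset.sum_div]
  refine Finset.sum_congr rfl fun j hj => ?_
  have hj' : j < K := by simpa using hj
  rw [cF, if_pos (by omega)]
  simp only [Nat.add_sub_cancel]
  rw [mul_pow, pow_succ x]
  field_simp

/-- the rate function -/
def fR (μ : ℝ) : ℝ := (min μ 1 - min μ 1 ^ 2 / 2) / μ - 1 - Real.log (min μ 1) + min μ 1 + Real.log μ

lemma fact_le (n : ℕ) (hn : 1 ≤ n) : (n ! : ℝ) ≤ Real.exp 1 * n * (n / Real.exp 1) ^ n := by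
  induction n, hn using Nat.le_induction with
  | base => 
    have := Real.exp_pos 1
    simp
  | succ n hn ih =>
    have hn0 : (0:ℝ) < n := by exact_mod_cast hn
    have h1 : Real.exp 1 * (n:ℝ) ^ (n + 1) ≤ ((n:ℝ) + 1) ^ (n + 1) := by
      have h2 : -(1 / ((n:ℝ) + 1)) + 1 ≤ Real.exp (-(1 / ((n:ℝ) + 1))) := Real.add_one_le_exp _
      have h3 : (n : ℝ) / (n + 1) ≤ Real.exp (-(1 / ((n:ℝ) + 1))) := by
        refine le_trans (le_of_eq ?_) h2
        field_simp
        ring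
      have h4 := pow_le_pow_left₀ (by positivity) h3 (n + 1)
      rw [← Real.exp_nat_mul] at h4
      have h5 : ((n + 1 : ℕ) : ℝ) * -(1 / ((n:ℝ) + 1)) = -1 := by push_cast; field_simp
      rw [h5, div_pow, div_le_iff₀ (by positivity)] at h4
      calc Real.exp 1 * (n:ℝ) ^ (n + 1) ≤ Real.exp 1 * (Real.exp (-1) * ((n:ℝ) + 1) ^ (n + 1)) := by
            gcongr
        _ = _ := by rw [← mul_assoc, ← Real.exp_add]; simp
    rw [Nat.factorial_succ]
    push_cast
    have hE := Real.exp_pos 1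
    calc ((n:ℝ) + 1) * (n ! : ℝ) ≤ ((n:ℝ) + 1) * (Real.exp 1 * n * (n / Real.exp 1) ^ n) := by gcongr
      _ = ((n:ℝ) + 1) * (Real.exp 1 * (n:ℝ) ^ (n + 1)) / Real.exp 1 ^ n := by
          rw [div_pow]; field_simp; ring
      _ ≤ ((n:ℝ) + 1) * (((n:ℝ) + 1) ^ (n + 1)) / Real.exp 1 ^ n := by gcongr
      _ = _ := by rw [div_pow]; field_simp; ring

lemma F_upper {μ : ℝ} (hμ : 0 < μ) (K n : ℕ) (hn : 1 ≤ n) :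
    Aseq (cF (μ / n) K) n ≤ Real.exp 1 * n * Real.exp (n * fR μ) := by
  have hn0 : (0:ℝ) < n := by exact_mod_cast hn
  set t := min μ 1 with ht
  have ht0 : 0 < t := lt_min hμ one_pos
  have ht1 : t ≤ 1 := min_le_right _ _
  set x := μ / n with hx
  have hx0 : 0 < x := by positivity
  set z := t * Real.exp (-t) / x with hz
  have hz0 : 0 < z := by positivity
  have h1 : Aseq (cF x K) n * (z ^ n / (n ! : ℝ)) ≤ Real.exp (Uk K (x * z) / x) :=
    le_hasSum (FK_hasSum hx0 K z) n (fun j _ => mul_nonneg (Aseq_nonneg (cF_nonneg hx0.le K) _)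
      (by positivity))
  have h2 : x * z = t * Real.exp (-t) := by rw [hz]; field_simp
  rw [h2] at h1
  have h3 : Real.exp (Uk K (t * Real.exp (-t)) / x) ≤ Real.exp ((t - t ^ 2 / 2) / x) := by
    have := Uk_upper K ht0.le ht1
    gcongr
  have h4 := h1.trans h3
  have hf : (0:ℝ) < n ! := by exact_mod_cast Nat.factorial_pos n
  rw [← mul_div_assoc, div_le_iff₀ hf, ← le_div_iff₀ (by positivity)] at h4
  refine h4.trans ?_
  rw [div_le_iff₀ (by positivity)]
  refine (mul_le_mul_of_nonneg_left (fact_le n hn) (Real.exp_pos _).le).trans (le_of_eq ?_)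
  have h5 : z = Real.exp (Real.log t - t - Real.log μ + Real.log n) := by
    rw [Real.exp_add, Real.exp_sub, Real.exp_sub, Real.exp_log ht0, Real.exp_log hμ,
      Real.exp_log hn0, hz, hx, Real.exp_neg]
    field_simp
  have h6 : (n : ℝ) / Real.exp 1 = Real.exp (Real.log n - 1) := by
    rw [Real.exp_sub, Real.exp_log hn0]
  rw [h5, h6, ← Real.exp_nat_mul, ← Real.exp_nat_mul]
  have h7 : ∀ a b c d e : ℝ, a + c = d + e →
      Real.exp a * (Real.exp 1 * n * Real.exp c) = Real.exp 1 * n * Real.exp d * Real.exp e := by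
    intro a b c d e h
    have : Real.exp a * Real.exp c = Real.exp d * Real.exp e := by
      rw [← Real.exp_add, ← Real.exp_add, h]
    linear_combination (Real.exp 1 * n) * this
  refine h7 _ 0 _ _ _ ?_
  rw [fR, ← ht, hx]
  field_simp
  ring

lemma window {a : ℕ → ℝ} (ha : ∀ j, 0 ≤ a j) {E : ℝ → ℝ}
    (hE : ∀ s, HasSum (fun j => a j * Real.exp (s * j)) (E s)) (n : ℕ) (β s₁ s₂ : ℝ)
    (h₁ : 0 ≤ s₁) (h₂ : 0 ≤ s₂) :
    E 0 ≤ (∑ j ∈ (Finset.range (n + 1)).filter (fun j : ℕ => β ≤ (j : ℝ)), a j) +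
      Real.exp (-(s₁ * n)) * E s₁ + Real.exp (s₂ * β) * E (-s₂) := by
  classical
  set W := (Finset.range (n + 1)).filter (fun j : ℕ => β ≤ (j : ℝ)) with hW
  have hw : HasSum (fun j => if j ∈ W then a j else 0) (∑ j ∈ W, a j) := by
    have := hasSum_sum_of_ne_finset_zero (L := .unconditional ℕ)
      (f := fun j => if j ∈ W then a j else 0) (s := W) (fun b hb => if_neg hb)
    rwa [Finset.sum_congr rfl (g := a) (fun j hj => if_pos hj)] at this
  refine hasSum_le ?_ (hE 0) ((hw.add ((hE s₁).mul_left (Real.exp (-(s₁ * n))))).add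
    ((hE (-s₂)).mul_left (Real.exp (s₂ * β))))
  intro j
  simp only [zero_mul, Real.exp_zero, mul_one]
  have e1 : Real.exp (-(s₁ * n)) * (a j * Real.exp (s₁ * j)) = a j * Real.exp (s₁ * (j - n)) := by
    rw [mul_left_comm, ← Real.exp_add]; congr 2; ring
  have e2 : Real.exp (s₂ * β) * (a j * Real.exp (-s₂ * j)) = a j * Real.exp (s₂ * (β - j)) := by
    rw [mul_left_comm, ← Real.exp_add]; congr 2; ring
  rw [e1, e2]
  have p1 : 0 ≤ a j * Real.exp (s₁ * (j - n)) := mul_nonneg (ha j) (Real.exp_pos _).le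
  have p2 : 0 ≤ a j * Real.exp (s₂ * (β - j)) := mul_nonneg (ha j) (Real.exp_pos _).le
  have haj := ha j
  by_cases hj : j ∈ W
  · rw [if_pos hj]; linarith
  · rw [if_neg hj]
    by_cases hjn : j ≤ n
    · have hb : (j:ℝ) < β := by
        by_contra hb
        exact hj (Finset.mem_filter.2 ⟨Finset.mem_range.2 (by omega), not_lt.1 hb⟩)
      have : 1 ≤ Real.exp (s₂ * (β - j)) := Real.one_le_exp (mul_nonneg h₂ (by linarith))
      nlinarith
    · have hb : (n:ℝ) < j := by exact_mod_cast not_le.1 hjn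
      have : 1 ≤ Real.exp (s₁ * (j - n)) := Real.one_le_exp (mul_nonneg h₁ (by linarith))
      nlinarith

end ForestF

section ForestLower
open Nat

lemma wK_exists {m η : ℝ} (hm : 0 < m) (hη : 0 < η) :
    ∀ᶠ K in atTop, ∃ w, min m 1 * Real.exp (-min m 1) ≤ w ∧
      w ≤ min m 1 * Real.exp (-min m 1) * Real.exp η ∧ Tk K w = m := by
  set t := min m 1 with ht
  have ht0 : 0 < t := lt_min hm one_pos
  set ws := t * Real.exp (-t) with hws
  have hws0 : 0 < ws := by positivity
  have hlt : ws < ws * Real.exp η := by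
    have : 1 < Real.exp η := Real.one_lt_exp_iff.2 hη
    nlinarith
  have h1 : ∃ K, m < Tk K (ws * Real.exp η) := by
    by_contra hcon
    push Not at hcon
    obtain ⟨T, hT1, hT2, -, hT4⟩ := T_lim (by positivity) hcon
    rcases le_total m 1 with h | h
    · have ht' : t = m := min_eq_left h
      have : T * Real.exp (-T) ≤ m * Real.exp (-m) := by
        rcases hT1.lt_or_eq with h' | h'
        · exact (texp_lt hT2.le h' h).le
        · rw [h']
      rw [← hT4, ← ht'] at this
      linarith
    · have ht' : t = 1 := min_eq_right h
      have := texp_le_max T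
      rw [← hT4] at this
      have h2 : ws = Real.exp (-1) := by rw [hws, ht']; simp
      linarith
  obtain ⟨K0, hK0⟩ := h1
  filter_upwards [eventually_ge_atTop K0] with K hK
  have h2 : m < Tk K (ws * Real.exp η) := by
    refine hK0.trans_le ?_
    unfold Tk
    refine Finset.sum_le_sum_of_subset_of_nonneg (Finset.range_subset_range.2 hK) ?_
    intro n _ _
    have := Rseq_pos n
    positivity
  have h3 : Tk K ws ≤ m := (Tk_le K ht0.le).trans (min_le_left _ _)
  have hc : ContinuousOn (Tk K) (Icc ws (ws * Real.exp η)) := by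
    unfold Tk
    fun_prop
  obtain ⟨w, hw, hw'⟩ := intermediate_value_Icc hlt.le hc ⟨h3, h2.le⟩
  exact ⟨w, hw.1, hw.2, hw'⟩

lemma tilt_pos {Φ : ℝ → ℝ} {m : ℝ} (hΦ : HasDerivAt Φ m 0) {b : ℝ} (hb : m < b) :
    ∃ s, 0 < s ∧ Φ s - Φ 0 < s * b := by
  have h := hΦ.tendsto_slope_zero_right
  have h1 := (h.eventually (gt_mem_nhds hb)).and (eventually_mem_nhdsWithin)
  obtain ⟨s, hs1, hs2⟩ := h1.exists
  refine ⟨s, hs2, ?_⟩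
  have hs0 : 0 < s := hs2
  simp only [zero_add, smul_eq_mul] at hs1
  rw [inv_mul_lt_iff₀ hs0] at hs1
  exact hs1

lemma tilt_neg {Φ : ℝ → ℝ} {m : ℝ} (hΦ : HasDerivAt Φ m 0) {b : ℝ} (hb : b < m) :
    ∃ s, 0 < s ∧ Φ (-s) - Φ 0 < -(s * b) := by
  have h : HasDerivAt (fun s => Φ (-s)) (-m) 0 := by
    have := HasDerivAt.comp (h₂ := Φ) (h := fun s : ℝ => -s) (0:ℝ) (by simpa using hΦ) (hasDerivAt_neg (0:ℝ))
    refine this.congr_deriv ?_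
    simp
  obtain ⟨s, hs, h2⟩ := tilt_pos h (b := -b) (by linarith)
  refine ⟨s, hs, ?_⟩
  simp only [neg_zero] at h2
  linarith

lemma F_lower_core {μ η w : ℝ} (hμ : 0 < μ) (hη : 0 < η) (hη2 : η < 1 / 2) {K : ℕ} (hK : 1 ≤ K)
    (hw : 0 < w) (hT : Tk K w = μ * (1 - η)) :
    ∀ᶠ n : ℕ in atTop, Real.exp (n * (Uk K w / μ)) ≤
      2 * (n + 1) * Aseq (cF (μ / n) K) n *
        Real.exp (n * (Real.log (Real.exp 1 * w / (μ * (1 - 2 * η))) +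
          2 * η * |Real.log (Real.exp 1 * w / (μ * (1 - 2 * η)))|)) := by
  set Φ : ℝ → ℝ := fun s => Uk K (w * Real.exp s) with hΦd
  have hΦ : HasDerivAt Φ (μ * (1 - η)) 0 := by
    have := hasDerivAt_Uexp K w 0
    simpa [hT] using this
  have hΦ0 : Φ 0 = Uk K w := by simp [hΦd]
  obtain ⟨s₁, hs₁, h₁⟩ := tilt_pos hΦ (b := μ) (by nlinarith)
  obtain ⟨s₂, hs₂, h₂⟩ := tilt_neg hΦ (b := μ * (1 - 2 * η)) (by nlinarith)
  set κ₁ := s₁ - (Φ s₁ - Φ 0) / μ with hκ₁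
  have hκ₁0 : 0 < κ₁ := by
    rw [hκ₁, sub_pos, div_lt_iff₀ hμ]; exact h₁
  set κ₂ := -(s₂ * (1 - 2 * η)) - (Φ (-s₂) - Φ 0) / μ with hκ₂
  have hκ₂0 : 0 < κ₂ := by
    rw [hκ₂, sub_pos, div_lt_iff₀ hμ]; linarith
  have t1 : ∀ κ : ℝ, 0 < κ → ∀ᶠ n : ℕ in atTop, Real.exp (-(κ * n)) ≤ 1 / 4 := by
    intro κ hκ
    have : Tendsto (fun n : ℕ => Real.exp (-(κ * n))) atTop (𝓝 0) :=
      Real.tendsto_exp_neg_atTop_nhds_zero.comp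
        (tendsto_natCast_atTop_atTop.const_mul_atTop hκ)
    exact this.eventually (ge_mem_nhds (by norm_num))
  set Bs := Real.exp 1 * w / (μ * (1 - 2 * η)) with hBs
  have hη3 : 0 < 1 - 2 * η := by linarith
  have hBs0 : 0 < Bs := by positivity
  filter_upwards [t1 κ₁ hκ₁0, t1 κ₂ hκ₂0, eventually_ge_atTop 1] with n hn1 hn2 hn
  have hn0 : (0:ℝ) < n := by exact_mod_cast hn
  set x := μ / n with hx
  have hx0 : 0 < x := by positivity
  set z := w / x with hz
  have hz0 : 0 < z := by positivity
  set F := Aseq (cF x K) with hF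
  have hF0 : ∀ j, 0 ≤ F j := Aseq_nonneg (cF_nonneg hx0.le K)
  have hE : ∀ s, HasSum (fun j => F j * (z ^ j / (j ! : ℝ)) * Real.exp (s * j))
      (Real.exp (n * (Φ s / μ))) := by
    intro s
    have := FK_hasSum hx0 K (z * Real.exp s)
    have e : x * (z * Real.exp s) = w * Real.exp s := by rw [hz]; field_simp
    rw [e] at this
    have e2 : Uk K (w * Real.exp s) / x = n * (Φ s / μ) := by rw [hx, hΦd]; field_simp
    rw [e2] at this
    refine this.congr_fun fun j => ?_
    rw [mul_pow, ← Real.exp_nat_mul, mul_comm s]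
    ring
  have hwin := window (fun j => mul_nonneg (hF0 j) (by positivity)) hE n (n * (1 - 2 * η)) s₁ s₂
    hs₁.le hs₂.le
  have e1 : Real.exp (-(s₁ * n)) * Real.exp (n * (Φ s₁ / μ)) =
      Real.exp (-(κ₁ * n)) * Real.exp (n * (Φ 0 / μ)) := by
    rw [← Real.exp_add, ← Real.exp_add, hκ₁]; congr 1; ring
  have e2 : Real.exp (s₂ * (n * (1 - 2 * η))) * Real.exp (n * (Φ (-s₂) / μ)) =
      Real.exp (-(κ₂ * n)) * Real.exp (n * (Φ 0 / μ)) := by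
    rw [← Real.exp_add, ← Real.exp_add, hκ₂]; congr 1; ring
  rw [e1, e2] at hwin
  set E0 := Real.exp (n * (Φ 0 / μ)) with hE0
  have hE0p : 0 < E0 := Real.exp_pos _
  have hhalf : E0 ≤ 2 * ∑ j ∈ (Finset.range (n + 1)).filter (fun j : ℕ => n * (1 - 2 * η) ≤ (j : ℝ)),
      F j * (z ^ j / (j ! : ℝ)) := by
    nlinarith
  have hterm : ∀ j ∈ (Finset.range (n + 1)).filter (fun j : ℕ => n * (1 - 2 * η) ≤ (j : ℝ)),
      F j * (z ^ j / (j ! : ℝ)) ≤ F n * Real.exp (n * (Real.log Bs + 2 * η * |Real.log Bs|)) := by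
    intro j hj
    rw [Finset.mem_filter, Finset.mem_range] at hj
    have hjn : j ≤ n := by omega
    have hjn' : (j:ℝ) ≤ n := by exact_mod_cast hjn
    have hj0 : (0:ℝ) < j := lt_of_lt_of_le (by positivity) hj.2
    have g1 : F j ≤ F n := Aseq_step (cF_nonneg hx0.le K) (by
      rw [cF, if_pos hK]; simp [Rseq_zero]) hjn
    have g2 : z ^ j / (j ! : ℝ) ≤ Bs ^ j := by
      have h1 := Real.pow_div_factorial_le_exp (x := j) hj0.le j
      have h2 : z ^ j / (j ! : ℝ) = (z / j) ^ j * ((j:ℝ) ^ j / (j ! : ℝ)) := by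
        rw [← mul_div_assoc, ← mul_pow, div_mul_cancel₀ _ hj0.ne']
      rw [h2]
      calc (z / j) ^ j * ((j:ℝ) ^ j / (j ! : ℝ)) ≤ (z / j) ^ j * Real.exp j := by gcongr
        _ = (z / j * Real.exp 1) ^ j := by rw [mul_pow, ← Real.exp_nat_mul]; simp
        _ ≤ Bs ^ j := by
          refine pow_le_pow_left₀ (by positivity) ?_ _
          rw [hBs, hz, hx, div_mul_eq_mul_div, div_le_div_iff₀ hj0 (by positivity)]
          have : w / (μ / n) * Real.exp 1 * (μ * (1 - 2 * η)) =
              Real.exp 1 * w * (n * (1 - 2 * η)) := by field_simp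
          rw [this]
          exact mul_le_mul_of_nonneg_left hj.2 (by positivity)
    have g3 : Bs ^ j ≤ Real.exp (n * (Real.log Bs + 2 * η * |Real.log Bs|)) := by
      have : Bs ^ j = Real.exp (j * Real.log Bs) := by
        rw [Real.exp_nat_mul, Real.exp_log hBs0]
      rw [this, Real.exp_le_exp]
      have h1 := neg_abs_le (Real.log Bs)
      have h2 : (n - j) * -|Real.log Bs| ≤ (n - j) * Real.log Bs :=
        mul_le_mul_of_nonneg_left h1 (by linarith)
      have h3 : (n - j) * |Real.log Bs| ≤ (2 * η * n) * |Real.log Bs| :=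
        mul_le_mul_of_nonneg_right (by linarith) (abs_nonneg _)
      linarith
    exact mul_le_mul g1 (g2.trans g3) (by positivity) (hF0 n)
  have hsum := Finset.sum_le_card_nsmul _ _ _ hterm
  have hcard : (((Finset.range (n + 1)).filter (fun j : ℕ => n * (1 - 2 * η) ≤ (j : ℝ))).card : ℝ)
      ≤ n + 1 := by
    have := Finset.card_filter_le (Finset.range (n + 1)) (fun j : ℕ => n * (1 - 2 * η) ≤ (j : ℝ))
    rw [Finset.card_range] at this
    exact_mod_cast this
  rw [nsmul_eq_mul] at hsum
  have hsum2 := hsum.trans (mul_le_mul_of_nonneg_right hcard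
    (mul_nonneg (hF0 n) (Real.exp_pos (n * (Real.log Bs + 2 * η * |Real.log Bs|))).le))
  rw [← hΦ0]
  linarith

end ForestLower

section ForestLower2
open Nat

lemma ev_poly_le {δ : ℝ} (hδ : 0 < δ) (a b : ℝ) : ∀ᶠ n : ℕ in atTop, a * n + b ≤ Real.exp (n * δ) := by
  have h1 : (fun n : ℕ => a * (n:ℝ) + b) =o[atTop] fun n : ℕ => (n : ℝ) ^ 2 := by
    have := (Polynomial.isLittleO_atTop_of_degree_lt (P := Polynomial.C a * Polynomial.X + Polynomial.C b)
      (Q := Polynomial.X ^ 2) (by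
        refine (Polynomial.degree_linear_le).trans_lt ?_
        simp))
    have := this.comp_tendsto tendsto_natCast_atTop_atTop (k := fun n : ℕ => (n:ℝ))
    simpa [Function.comp_def] using this
  have h2 : (fun n : ℕ => (n : ℝ) ^ 2) =o[atTop] fun n : ℕ => Real.exp (n * δ) := by
    have := (isLittleO_pow_exp_pos_mul_atTop 2 hδ).comp_tendsto tendsto_natCast_atTop_atTop (k := fun n : ℕ => (n:ℝ))
    simpa [Function.comp_def, mul_comm] using this
  filter_upwards [(h1.trans h2).bound one_pos] with n hn
  rw [one_mul, Real.norm_eq_abs, Real.norm_eq_abs, abs_of_pos (Real.exp_pos _)] at hn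
  exact (le_abs_self _).trans hn

/-- auxiliary logarithm -/
def lsF (μ η : ℝ) : ℝ := 1 + Real.log (min (μ * (1 - η)) 1) - min (μ * (1 - η)) 1 + η - Real.log μ
  - Real.log (1 - 2 * η)

/-- auxiliary rate -/
def rF (μ η : ℝ) : ℝ := (1 - η) * (min (μ * (1 - η)) 1 - min (μ * (1 - η)) 1 ^ 2 / 2) / μ - lsF μ η
  - 2 * η * (|lsF μ η| + η)

lemma rF_tendsto {μ : ℝ} (hμ : 0 < μ) : Tendsto (rF μ) (𝓝 0) (𝓝 (fR μ)) := by
  have ht : 0 < min (μ * (1 - 0)) 1 := by simp [hμ]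
  have h1 : ContinuousAt (lsF μ) 0 := by
    unfold lsF
    have a1 : ContinuousAt (fun η : ℝ => Real.log (min (μ * (1 - η)) 1)) 0 :=
      ContinuousAt.log (by fun_prop) ht.ne'
    have a2 : ContinuousAt (fun η : ℝ => Real.log (1 - 2 * η)) 0 :=
      ContinuousAt.log (by fun_prop) (by norm_num)
    have a3 : ContinuousAt (fun η : ℝ => min (μ * (1 - η)) 1) 0 := by fun_prop
    exact ((((continuousAt_const.add a1).sub a3).add continuousAt_id).sub continuousAt_const).sub a2
  have h2 : ContinuousAt (rF μ) 0 := by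
    unfold rF
    have a4 : ContinuousAt (fun η : ℝ => (1 - η) * (min (μ * (1 - η)) 1 - min (μ * (1 - η)) 1 ^ 2 / 2) / μ) 0 := by
      fun_prop
    have a5 : ContinuousAt (fun η : ℝ => 2 * η) 0 := by fun_prop
    exact (a4.sub h1).sub (a5.mul (h1.abs.add continuousAt_id))
  have h3 : rF μ 0 = fR μ := by
    simp [rF, lsF, fR]
    ring
  rw [← h3]
  exact h2

lemma F_lower {μ δ : ℝ} (hμ : 0 < μ) (hδ : 0 < δ) :
    ∃ K, ∀ᶠ n : ℕ in atTop, Real.exp (n * (fR μ - δ)) ≤ Aseq (cF (μ / n) K) n := by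
  have h0 : ∀ᶠ η in 𝓝[>] (0:ℝ), fR μ - δ / 2 < rF μ η ∧ η < 1 / 2 ∧ 0 < η := by
    refine Filter.Eventually.and ?_ (Filter.Eventually.and ?_ eventually_mem_nhdsWithin)
    · exact ((rF_tendsto hμ).mono_left nhdsWithin_le_nhds).eventually (lt_mem_nhds (by linarith))
    · exact (lt_mem_nhds (by norm_num : (0:ℝ) < 1 / 2) |> fun h => nhdsWithin_le_nhds (gt_mem_nhds (by norm_num)))
  obtain ⟨η, hr, hη2, hη⟩ := h0.exists
  have hm : 0 < μ * (1 - η) := mul_pos hμ (by linarith)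
  obtain ⟨K, ⟨w, hw1, hw2, hT⟩, hU, hK⟩ :=
    ((wK_exists hm hη).and ((Uk_lower hη).and (eventually_ge_atTop 1))).exists
  refine ⟨K, ?_⟩
  set t := min (μ * (1 - η)) 1 with ht
  have ht0 : 0 < t := lt_min hm one_pos
  have hws : 0 < t * Real.exp (-t) := by positivity
  have hw : 0 < w := hws.trans_le hw1
  have hUw : (1 - η) * (t - t ^ 2 / 2) ≤ Uk K w :=
    (hU t ⟨ht0.le, min_le_right _ _⟩).trans (Uk_mono K hws.le hw1)
  have hη3 : 0 < 1 - 2 * η := by linarith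
  set lB := Real.log (Real.exp 1 * w / (μ * (1 - 2 * η))) with hlB
  have elB : lB = 1 + Real.log w - Real.log μ - Real.log (1 - 2 * η) := by
    rw [hlB, Real.log_div (by positivity) (by positivity), Real.log_mul (by positivity) hw.ne',
      Real.log_mul hμ.ne' hη3.ne', Real.log_exp]
    ring
  have lw1 : Real.log t - t ≤ Real.log w := by
    have := Real.log_le_log hws hw1
    rwa [Real.log_mul ht0.ne' (by positivity), Real.log_exp, ← sub_eq_add_neg] at this
  have lw2 : Real.log w ≤ Real.log t - t + η := by
    have := Real.log_le_log hw hw2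
    rwa [Real.log_mul (by positivity) (by positivity), Real.log_mul ht0.ne' (by positivity),
      Real.log_exp, Real.log_exp, ← sub_eq_add_neg] at this
  have els : lsF μ η = 1 + Real.log t - t + η - Real.log μ - Real.log (1 - 2 * η) := by
    rw [lsF]
  have b1 : lB ≤ lsF μ η := by rw [elB, els]; linarith
  have b2 : |lB| ≤ |lsF μ η| + η := by
    have b3 : |lB - lsF μ η| ≤ η := by
      rw [abs_le, elB, els]; constructor <;> linarith
    have := abs_sub_abs_le_abs_sub lB (lsF μ η)
    linarith
  have hrate : rF μ η ≤ Uk K w / μ - (lB + 2 * η * |lB|) := by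
    rw [rF, ← ht]
    have c1 : (1 - η) * (t - t ^ 2 / 2) / μ ≤ Uk K w / μ := by gcongr
    have c2 : 2 * η * |lB| ≤ 2 * η * (|lsF μ η| + η) :=
      mul_le_mul_of_nonneg_left b2 (by linarith)
    linarith
  filter_upwards [F_lower_core hμ hη hη2 hK hw hT, ev_poly_le (half_pos hδ) 2 2] with n hn hp
  have hF0 : 0 ≤ Aseq (cF (μ / n) K) n := Aseq_nonneg (cF_nonneg (by positivity) K) n
  set D := lB + 2 * η * |lB| with hD
  have s1 : Real.exp (n * (Uk K w / μ)) ≤ Real.exp (n * (δ / 2)) * Aseq (cF (μ / n) K) n * Real.exp (n * D) := by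
    refine hn.trans ?_
    gcongr
    linarith
  have s2 : Real.exp (n * (fR μ - δ)) * (Real.exp (n * (δ / 2)) * Real.exp (n * D)) ≤ Real.exp (n * (Uk K w / μ)) := by
    rw [← Real.exp_add, ← Real.exp_add, Real.exp_le_exp, ← mul_add, ← mul_add]
    exact mul_le_mul_of_nonneg_left (by linarith) (by positivity)
  have s3 : 0 < Real.exp (n * (δ / 2)) * Real.exp (n * D) := by positivity
  refine le_of_mul_le_mul_right ?_ s3
  calc _ ≤ _ := s2
    _ ≤ _ := s1
    _ = _ := by ring

end ForestLower2

/-! ### Random cluster partition functions -/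

section RC
open Classical

lemma eN_le {n : ℕ} (G : SimpleGraph (Fin n)) : eN G ≤ n * (n - 1) / 2 := by
  have := G.card_edgeFinset_le_card_choose_two
  rw [Fintype.card_fin, Nat.choose_two_right] at this
  rw [eN, Set.ncard_eq_toFinset_card']
  exact this

/-- weight of a graph -/
def wt {n : ℕ} (y q : ℝ) (G : SimpleGraph (Fin n)) : ℝ := y ^ eN G * q ^ Nat.card G.ConnectedComponent

lemma rcW_eq {n : ℕ} {p : ℝ} (hp1 : p < 1) (q : ℝ) (G : SimpleGraph (Fin n)) :
    rcW n p q G = (1 - p) ^ (n * (n - 1) / 2) * wt (p / (1 - p)) q G := by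
  have h := eN_le G
  have h1 : 1 - p ≠ 0 := by linarith
  rw [rcW, wt]
  change p ^ eN G * (1 - p) ^ (n * (n - 1) / 2 - eN G) * _ = _
  have h2 : (1 - p) ^ (n * (n - 1) / 2) = (1 - p) ^ (n * (n - 1) / 2 - eN G) * (1 - p) ^ eN G := by
    rw [← pow_add, Nat.sub_add_cancel h]
  rw [h2, div_pow]
  field_simp

lemma Zrc_eq {n : ℕ} {lam : ℝ} (h : lam / n < 1) (q : ℝ) (A : Set (SimpleGraph (Fin n))) :
    Zrc n lam q A = (1 - lam / n) ^ (n * (n - 1) / 2) *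
      ∑ G ∈ Finset.univ.filter (fun G => G ∈ A), wt (lam / n / (1 - lam / n)) q G := by
  rw [Zrc, ZP, Finset.mul_sum, ← Finset.sum_congr rfl (fun G _ => rcW_eq h q G)]
  rw [finsum_mem_eq_toFinset_sum]
  refine Finset.sum_congr ?_ fun _ _ => rfl
  ext G
  simp

lemma wt_acyclic {n : ℕ} {y q : ℝ} (hq : 0 < q) {G : SimpleGraph (Fin n)} (hG : G.IsAcyclic) :
    wt y q G = q ^ n * (y / q) ^ eN G := by
  have h := acyclic_count hG
  rw [Fintype.card_fin] at h
  have hqn : q ^ n = q ^ eN G * q ^ Nat.card G.ConnectedComponent := by rw [← pow_add, h]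
  rw [wt, hqn, div_pow]
  field_simp

lemma wt_nonneg {n : ℕ} {y q : ℝ} (hy : 0 ≤ y) (hq : 0 ≤ q) (G : SimpleGraph (Fin n)) :
    0 ≤ wt y q G := by
  rw [wt]; positivity

lemma sum_forest {n : ℕ} {y q : ℝ} (hq : 0 < q) (K : ℕ) :
    ∑ G ∈ (Finset.univ : Finset (SimpleGraph (Fin n))).filter (IsFo K Finset.univ), wt y q G =
      q ^ n * Aseq (cF (y / q) K) n := by
  rw [← foS_eq (y / q) K n (Finset.univ : Finset (Fin n)) (by simp), foS, Finset.mul_sum]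
  refine Finset.sum_congr (by ext G; simp only [Finset.mem_filter, Finset.mem_univ, true_and])
    fun G hG => ?_
  exact wt_acyclic hq (Finset.mem_filter.1 hG).2.1

lemma compSize_eq {n : ℕ} (G : SimpleGraph (Fin n)) (v : Fin n) :
    compSize G v = {b | G.Reachable v b}.ncard := by
  rw [compSize]
  congr 1
  ext b
  simp only [SimpleGraph.ConnectedComponent.mem_supp_iff, SimpleGraph.ConnectedComponent.eq,
    Set.mem_setOf_eq]
  exact ⟨fun h => h.symm, fun h => h.symm⟩

lemma zL {n : ℕ} {lam q : ℝ} (h : lam / n < 1) (hq : 0 < q) :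
    Zrc n lam q (Lev n) = (1 - lam / n) ^ (n * (n - 1) / 2) *
      (q ^ n * Aseq (cF (lam / n / (1 - lam / n) / q) n) n) := by
  rw [Zrc_eq h, ← sum_forest hq]
  congr 1
  refine Finset.sum_congr ?_ fun _ _ => rfl
  ext G
  simp only [Finset.mem_filter, Finset.mem_univ, true_and, Lev, Set.mem_setOf_eq, IsFo]
  constructor
  · intro h
    refine ⟨h, by simp, fun a _ => ?_⟩
    have := Set.ncard_le_card {b | G.Reachable a b}
    simpa using this
  · exact fun h => h.1

lemma zB_lower {n : ℕ} {lam q r : ℝ} (h0 : 0 ≤ lam) (h : lam / n < 1) (hq : 0 < q) {K : ℕ}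
    (hK : (K : ℝ) ≤ r) :
    (1 - lam / n) ^ (n * (n - 1) / 2) * (q ^ n * Aseq (cF (lam / n / (1 - lam / n) / q) K) n) ≤
      Zrc n lam q (Bev n r) := by
  have hp : 0 < 1 - lam / n := by linarith
  rw [Zrc_eq h, ← sum_forest hq]
  refine mul_le_mul_of_nonneg_left ?_ (by positivity)
  refine Finset.sum_le_sum_of_subset_of_nonneg ?_ fun G _ _ => wt_nonneg (by positivity) hq.le G
  intro G hG
  simp only [Finset.mem_filter, Finset.mem_univ, true_and, Bev, Set.mem_setOf_eq, IsFo] at hG ⊢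
  intro v
  rw [compSize_eq]
  refine le_trans ?_ hK
  exact_mod_cast hG.2.2 v trivial

/-- graph joining all pairs of vertices in the same component -/
def clos {n : ℕ} (F : SimpleGraph (Fin n)) : SimpleGraph (Fin n) where
  Adj a b := a ≠ b ∧ F.Reachable a b
  symm := ⟨fun _ _ h => ⟨h.1.symm, h.2.symm⟩⟩
  loopless := ⟨fun _ h => h.1 rfl⟩

lemma clos_card {n : ℕ} {r : ℝ} (F : SimpleGraph (Fin n)) (hF : F ∈ Bev n r) :
    ((clos F).edgeFinset.card : ℝ) ≤ r * n := by
  have h1 := (clos F).sum_degrees_eq_twice_card_edges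
  have h2 : ∀ v, ((clos F).degree v : ℝ) ≤ r := by
    intro v
    refine le_trans ?_ (hF v)
    rw [compSize_eq, Set.ncard_eq_toFinset_card', ← SimpleGraph.card_neighborFinset_eq_degree]
    norm_cast
    refine Finset.card_le_card fun b hb => ?_
    rw [SimpleGraph.mem_neighborFinset] at hb
    simpa using hb.2
  have h3 : (∑ v, ((clos F).degree v : ℝ)) ≤ ∑ v : Fin n, r := Finset.sum_le_sum fun v _ => h2 v
  have h4 : (∑ v, ((clos F).degree v : ℝ)) = 2 * ((clos F).edgeFinset.card : ℝ) := by
    exact_mod_cast h1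
  rw [h4] at h3
  simp at h3
  have : (0:ℝ) ≤ (clos F).edgeFinset.card := by positivity
  linarith

lemma card_CC {n : ℕ} {F G : SimpleGraph (Fin n)} (h : F.Reachable = G.Reachable) :
    Nat.card F.ConnectedComponent = Nat.card G.ConnectedComponent := by
  have : F.ConnectedComponent = G.ConnectedComponent := by
    unfold SimpleGraph.ConnectedComponent
    rw [h]
  rw [this]

lemma zB_upper {n : ℕ} {lam q r : ℝ} (h0 : 0 ≤ lam) (h : lam / n < 1) (hq : 0 < q) :
    Zrc n lam q (Bev n r) ≤ Real.exp (lam / n / (1 - lam / n) * (r * n)) * Zrc n lam q (Lev n) := by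
  have hp : 0 < 1 - lam / n := by linarith
  rw [Zrc_eq h, Zrc_eq h, mul_left_comm]
  refine mul_le_mul_of_nonneg_left ?_ (by positivity)
  set y := lam / n / (1 - lam / n) with hy
  have hy0 : 0 ≤ y := by positivity
  choose sf hle hac hre using fun G : SimpleGraph (Fin n) => G.exists_isAcyclic_reachable_eq_le
  have hmaps : ∀ G ∈ Finset.univ.filter (fun G => G ∈ Bev n r),
      sf G ∈ Finset.univ.filter (fun G => G ∈ Lev n) := by
    intro G _
    exact Finset.mem_filter.2 ⟨Finset.mem_univ _, hac G⟩
  rw [← Finset.sum_fiberwise_of_maps_to hmaps, Finset.mul_sum]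
  refine Finset.sum_le_sum fun F hF => ?_
  by_cases hne : ((Finset.univ.filter (fun G => G ∈ Bev n r)).filter (fun G => sf G = F)).Nonempty
  swap
  · rw [Finset.not_nonempty_iff_eq_empty.1 hne, Finset.sum_empty]
    exact mul_nonneg (Real.exp_pos _).le (wt_nonneg hy0 hq.le F)
  have hFB : F ∈ Bev n r := by
    obtain ⟨G, hG⟩ := hne
    simp only [Finset.mem_filter, Finset.mem_univ, true_and] at hG
    intro v
    have := hG.1 v
    rw [compSize_eq] at this ⊢
    rwa [← hre G, hG.2] at this
  have hcl := clos_card F hFB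
  have hpow : ∑ S ∈ (clos F).edgeFinset.powerset, y ^ S.card ≤ Real.exp (y * (r * n)) := by
    have e : ∑ S ∈ (clos F).edgeFinset.powerset, y ^ S.card = (1 + y) ^ (clos F).edgeFinset.card := by
      have := Finset.prod_one_add (f := fun _ => y) (clos F).edgeFinset
      simpa using this.symm
    rw [e]
    calc (1 + y) ^ (clos F).edgeFinset.card ≤ Real.exp y ^ (clos F).edgeFinset.card := by
          refine pow_le_pow_left₀ (by positivity) ?_ _
          rw [add_comm]; exact Real.add_one_le_exp y
      _ = Real.exp (y * (clos F).edgeFinset.card) := by rw [← Real.exp_nat_mul, mul_comm]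
      _ ≤ _ := by
        rw [Real.exp_le_exp]
        exact mul_le_mul_of_nonneg_left hcl hy0
  refine le_trans ?_ (mul_le_mul_of_nonneg_right hpow (wt_nonneg hy0 hq.le F))
  rw [Finset.sum_mul]
  have hG : ∀ G ∈ (Finset.univ.filter (fun G => G ∈ Bev n r)).filter (fun G => sf G = F),
      wt y q G = (fun S : Finset (Sym2 (Fin n)) => y ^ S.card * wt y q F)
        (G.edgeFinset \ F.edgeFinset) := by
    intro G hG
    simp only [Finset.mem_filter, Finset.mem_univ, true_and] at hG
    have hFG : F ≤ G := hG.2 ▸ hle G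
    have hFr : F.Reachable = G.Reachable := hG.2 ▸ hre G
    simp only [wt]
    rw [card_CC hFr, ← mul_assoc, ← pow_add]
    congr 2
    have hs : F.edgeFinset ⊆ G.edgeFinset := SimpleGraph.edgeFinset_mono hFG
    rw [Finset.card_sdiff_of_subset hs]
    have := Finset.card_le_card hs
    have e1 : eN G = G.edgeFinset.card := by
      rw [eN, Set.ncard_eq_toFinset_card', SimpleGraph.edgeFinset]
    have e2 : eN F = F.edgeFinset.card := by
      rw [eN, Set.ncard_eq_toFinset_card', SimpleGraph.edgeFinset]
    omega
  rw [Finset.sum_congr rfl hG]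
  have hinj : Set.InjOn (fun G : SimpleGraph (Fin n) => G.edgeFinset \ F.edgeFinset)
      ((Finset.univ.filter (fun G => G ∈ Bev n r)).filter (fun G => sf G = F) : Finset _) := by
    intro G hG G' hG' he
    simp only [Finset.coe_filter, Finset.mem_filter, Finset.mem_univ, true_and, Set.mem_setOf_eq] at hG hG'
    have hs : F.edgeFinset ⊆ G.edgeFinset := SimpleGraph.edgeFinset_mono (hG.2 ▸ hle G)
    have hs' : F.edgeFinset ⊆ G'.edgeFinset := SimpleGraph.edgeFinset_mono (hG'.2 ▸ hle G')
    simp only at he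
    have : G.edgeFinset = G'.edgeFinset := by
      rw [← Finset.sdiff_union_of_subset hs, he, Finset.sdiff_union_of_subset hs']
    exact SimpleGraph.edgeFinset_inj.1 this
  rw [← Finset.sum_image (f := fun S : Finset (Sym2 (Fin n)) => y ^ S.card * wt y q F) hinj]
  refine Finset.sum_le_sum_of_subset_of_nonneg ?_ fun S _ _ =>
    mul_nonneg (by positivity) (wt_nonneg hy0 hq.le F)
  intro S hS
  obtain ⟨G, hG, rfl⟩ := Finset.mem_image.1 hS
  simp only [Finset.mem_filter, Finset.mem_univ, true_and] at hG
  rw [Finset.mem_powerset]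
  intro e he
  have he' := (Finset.mem_sdiff.1 he).1
  rw [SimpleGraph.mem_edgeFinset] at he' ⊢
  induction e using Sym2.ind with
  | _ a b =>
    rw [SimpleGraph.mem_edgeSet] at he' ⊢
    refine ⟨he'.ne, ?_⟩
    have : (sf G).Reachable a b := by rw [hre G]; exact he'.reachable
    rwa [hG.2] at this

end RC

/-! ### Uniform bounds -/

section Unif

lemma fR_eq {μ : ℝ} (hμ : 0 < μ) : fR μ = Psi μ + μ / 2 := by
  have hs : Real.sinh (Real.log μ) = (μ - 1 / μ) / 2 := by
    rw [Real.sinh_eq, Real.exp_neg, Real.exp_log hμ, one_div]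
  rcases le_total μ 1 with h | h
  · have h1 := Real.sinh_le_self_iff.2 (Real.log_nonpos hμ.le h)
    rw [hs] at h1
    rw [fR, Psi, min_eq_left h, min_eq_right (by linarith)]
    field_simp
    ring
  · have h1 := Real.self_le_sinh_iff.2 (Real.log_nonneg h)
    rw [hs] at h1
    rw [fR, Psi, min_eq_right h, min_eq_left (by linarith)]
    simp only [Real.log_one]
    field_simp
    ring

/-- limiting free energy -/
def Gf (q l : ℝ) : ℝ := Psi (l / q) - ((q - 1) / (2 * q)) * l + Real.log q

lemma Gf_eq {q l : ℝ} (hq : 0 < q) (hl : 0 < l) : Gf q l = Real.log q - l / 2 + fR (l / q) := by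
  rw [Gf, fR_eq (by positivity)]
  field_simp
  ring

lemma fR_cont {q l : ℝ} (hq : 0 < q) (hl : 0 < l) : ContinuousAt (fun l => fR (l / q)) l := by
  have h1 : ContinuousAt (fun l => Psi (l / q) + l / q / 2) l := by
    unfold Psi
    have h2 : ContinuousAt (fun l : ℝ => l / q) l := by fun_prop
    have h3 : l / q ≠ 0 := by positivity
    exact (((h2.log h3).sub ((h2.sub (continuousAt_const.div h2 h3)).div_const 2)).min
      continuousAt_const).add (h2.div_const 2)
  refine h1.congr ?_
  filter_upwards [lt_mem_nhds hl] with x hx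
  rw [fR_eq (by positivity)]

/-- truncated forest partition function -/
def SK (q l : ℝ) (n K : ℕ) : ℝ := (1 - l / n) ^ (n * (n - 1) / 2) *
    (q ^ n * Aseq (cF (l / n / (1 - l / n) / q) K) n)

lemma castN (n : ℕ) : ((n * (n - 1) / 2 : ℕ) : ℝ) = n * (n - 1) / 2 := by
  rw [← Nat.choose_two_right, Nat.cast_choose_two]

lemma local_upper {q l0 δ : ℝ} (hq : 0 < q) (hl0 : 0 < l0) (hδ : 0 < δ) :
    ∃ U ∈ 𝓝 l0, ∀ᶠ n : ℕ in atTop, ∀ l ∈ U, ∀ K, SK q l n K ≤ Real.exp (n * (Gf q l + δ)) := by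
  have hc := fR_cont hq hl0
  have e1 : ∀ᶠ l1 in 𝓝[>] l0, fR (l1 / q) < fR (l0 / q) + δ / 4 ∧ l0 < l1 :=
    Filter.Eventually.and (nhdsWithin_le_nhds (hc.eventually (gt_mem_nhds (by linarith))))
      eventually_mem_nhdsWithin
  obtain ⟨l1, hl1, hl01⟩ := e1.exists
  have e2 : ∀ᶠ l in 𝓝 l0, l0 / 2 < l ∧ l < (l0 + l1) / 2 ∧ fR (l0 / q) - δ / 4 < fR (l / q) :=
    Filter.Eventually.and (lt_mem_nhds (by linarith)) (Filter.Eventually.and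
      (gt_mem_nhds (by linarith)) (hc.eventually (lt_mem_nhds (by linarith))))
  refine ⟨_, e2, ?_⟩
  set l2 := (l0 + l1) / 2 with hl2
  have hnat : Tendsto (fun n : ℕ => (n : ℝ)) atTop atTop := tendsto_natCast_atTop_atTop
  filter_upwards [hnat.eventually_gt_atTop l2, hnat.eventually_ge_atTop (l1 * l2 / (l1 - l2)),
    hnat.eventually_ge_atTop (2 * l2 / δ), ev_poly_le (δ := δ / 4) (by linarith) (Real.exp 1) 0,
    eventually_ge_atTop 1]
    with n n1 n2 n3 n4 n5
  rintro l ⟨k1, k2, k3⟩ K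
  have hn0 : (0:ℝ) < n := by exact_mod_cast n5
  have hl : 0 < l := by linarith
  have h12 : 0 < l1 - l2 := by linarith
  have hln : l < n := by linarith
  have hp1 : 0 < 1 - l / n := by
    rw [sub_pos, div_lt_one hn0]; exact hln
  have hx : l / n / (1 - l / n) / q ≤ l1 / q / n := by
    have a1 : l / n / (1 - l / n) = l / (n - l) := by
      have : (n:ℝ) - l ≠ 0 := by linarith
      field_simp
    rw [a1, div_right_comm l1]
    refine div_le_div_of_nonneg_right ?_ hq.le
    rw [div_le_div_iff₀ (by linarith) hn0]
    rw [div_le_iff₀ h12] at n2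
    nlinarith
  have hx0 : 0 ≤ l / n / (1 - l / n) / q := by positivity
  have hA : Aseq (cF (l / n / (1 - l / n) / q) K) n ≤ Real.exp (n * (δ / 4)) * Real.exp (n * fR (l1 / q)) := by
    refine (Aseq_mono (cF_nonneg hx0 K) (cF_mono hx0 hx le_rfl) n).trans ?_
    have hl1p : 0 < l1 := by linarith
    refine (F_upper (by positivity) K n n5).trans ?_
    gcongr
    linarith
  have hB : (1 - l / n) ^ (n * (n - 1) / 2) ≤ Real.exp (n * (-(l / 2) + δ / 4)) := by
    have b1 : 1 - l / n ≤ Real.exp (-(l / n)) := by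
      have := Real.add_one_le_exp (-(l / n))
      linarith
    refine (pow_le_pow_left₀ hp1.le b1 _).trans ?_
    rw [← Real.exp_nat_mul, castN, Real.exp_le_exp]
    have b2 : (n:ℝ) * (n - 1) / 2 * -(l / n) = n * (-(l / 2)) + l / 2 := by field_simp; ring
    rw [b2]
    rw [div_le_iff₀ hδ] at n3
    nlinarith
  have hQ : q ^ n = Real.exp (n * Real.log q) := by rw [Real.exp_nat_mul, Real.exp_log hq]
  have hA0 : 0 ≤ Aseq (cF (l / n / (1 - l / n) / q) K) n := Aseq_nonneg (cF_nonneg hx0 K) n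
  rw [SK, hQ]
  calc _ ≤ Real.exp (n * (-(l / 2) + δ / 4)) * (Real.exp (n * Real.log q) *
      (Real.exp (n * (δ / 4)) * Real.exp (n * fR (l1 / q)))) := by gcongr
    _ = Real.exp (n * (Real.log q - l / 2 + δ / 2 + fR (l1 / q))) := by
      rw [← Real.exp_add, ← Real.exp_add, ← Real.exp_add]
      congr 1
      ring
    _ ≤ _ := by
      rw [Real.exp_le_exp, Gf_eq hq hl]
      exact mul_le_mul_of_nonneg_left (by linarith) hn0.le

lemma local_lower {q l0 δ : ℝ} (hq : 0 < q) (hl0 : 0 < l0) (hδ : 0 < δ) :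
    ∃ U ∈ 𝓝 l0, ∃ K, ∀ᶠ n : ℕ in atTop, ∀ l ∈ U, Real.exp (n * (Gf q l - δ)) ≤ SK q l n K := by
  have hc := fR_cont hq hl0
  have e1 : ∀ᶠ l1 in 𝓝[<] l0, fR (l0 / q) - δ / 4 < fR (l1 / q) ∧ 0 < l1 ∧ l1 < l0 :=
    Filter.Eventually.and (nhdsWithin_le_nhds (hc.eventually (lt_mem_nhds (by linarith))))
      (Filter.Eventually.and (nhdsWithin_le_nhds (lt_mem_nhds hl0)) eventually_mem_nhdsWithin)
  obtain ⟨l1, hl1, hl10, hl01⟩ := e1.exists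
  have e2 : ∀ᶠ l in 𝓝 l0, l1 < l ∧ l < 2 * l0 ∧ fR (l / q) < fR (l0 / q) + δ / 4 :=
    Filter.Eventually.and (lt_mem_nhds (by linarith)) (Filter.Eventually.and
      (gt_mem_nhds (by linarith)) (hc.eventually (gt_mem_nhds (by linarith))))
  obtain ⟨K, hK⟩ := F_lower (μ := l1 / q) (δ := δ / 4) (by positivity) (by linarith)
  refine ⟨_, e2, K, ?_⟩
  have hnat : Tendsto (fun n : ℕ => (n : ℝ)) atTop atTop := tendsto_natCast_atTop_atTop
  filter_upwards [hnat.eventually_gt_atTop (2 * l0),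
    hnat.eventually_ge_atTop (2 * l0 + (2 * l0) ^ 2 / (δ / 2)), hK, eventually_ge_atTop 1]
    with n n1 n2 n3 n5
  rintro l ⟨k1, k2, k3⟩
  have hn0 : (0:ℝ) < n := by exact_mod_cast n5
  have hl : 0 < l := by linarith
  have hln : l < n := by linarith
  have hp1 : 0 < 1 - l / n := by
    rw [sub_pos, div_lt_one hn0]; exact hln
  have hnl : 0 < (n:ℝ) - l := by linarith
  have a1 : l / n / (1 - l / n) = l / (n - l) := by
    field_simp
  have hx : l1 / q / n ≤ l / n / (1 - l / n) / q := by
    rw [a1, div_right_comm l1]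
    refine div_le_div_of_nonneg_right ?_ hq.le
    rw [div_le_div_iff₀ hn0 (by linarith)]
    nlinarith
  have hx0 : 0 ≤ l1 / q / n := by positivity
  have hA : Real.exp (n * (fR (l1 / q) - δ / 4)) ≤ Aseq (cF (l / n / (1 - l / n) / q) K) n :=
    n3.trans (Aseq_mono (cF_nonneg hx0 K) (cF_mono hx0 hx le_rfl) n)
  have hB : Real.exp (n * (-(l / 2) - δ / 4)) ≤ (1 - l / n) ^ (n * (n - 1) / 2) := by
    have b1 : Real.exp (-(l / (n - l))) ≤ 1 - l / n := by
      rw [Real.exp_neg, inv_le_comm₀ (Real.exp_pos _) hp1]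
      have := Real.add_one_le_exp (l / (n - l))
      refine le_trans (le_of_eq ?_) this
      field_simp
      ring
    refine le_trans ?_ (pow_le_pow_left₀ (Real.exp_pos _).le b1 _)
    rw [← Real.exp_nat_mul, castN, Real.exp_le_exp]
    have b2 : (n - 1) * (l / (n - l)) ≤ l + δ / 2 := by
      rw [← mul_div_assoc, div_le_iff₀ hnl]
      have b3 : (2 * l0) ^ 2 / (δ / 2) ≤ n - 2 * l0 := by linarith
      rw [div_le_iff₀ (by linarith)] at b3
      nlinarith
    nlinarith
  have hQ : q ^ n = Real.exp (n * Real.log q) := by rw [Real.exp_nat_mul, Real.exp_log hq]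
  rw [SK, hQ]
  calc Real.exp (n * (Gf q l - δ)) ≤ Real.exp (n * (-(l / 2) - δ / 4)) * (Real.exp (n * Real.log q) *
      Real.exp (n * (fR (l1 / q) - δ / 4))) := by
        rw [← Real.exp_add, ← Real.exp_add, Real.exp_le_exp, Gf_eq hq hl, ← mul_add, ← mul_add]
        exact mul_le_mul_of_nonneg_left (by linarith) hn0.le
    _ ≤ _ := by gcongr

lemma unif_upper {q δ : ℝ} (hq : 0 < q) (hδ : 0 < δ) {C : Set ℝ} (hC : IsCompact C)
    (hC0 : C ⊆ Ioi 0) :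
    ∀ᶠ n : ℕ in atTop, ∀ l ∈ C, ∀ K, SK q l n K ≤ Real.exp (n * (Gf q l + δ)) := by
  refine hC.induction_on (p := fun C => ∀ᶠ n : ℕ in atTop, ∀ l ∈ C, ∀ K,
    SK q l n K ≤ Real.exp (n * (Gf q l + δ))) ?_ ?_ ?_ ?_
  · simp
  · intro s t hst h
    filter_upwards [h] with n hn l hl using hn l (hst hl)
  · intro s t h1 h2
    filter_upwards [h1, h2] with n hn1 hn2 l hl
    rcases hl with hl | hl
    · exact hn1 l hl
    · exact hn2 l hl
  · intro x hx
    obtain ⟨U, hU, h⟩ := local_upper hq (hC0 hx) hδ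
    exact ⟨U, nhdsWithin_le_nhds hU, h⟩

lemma SK_mono {q l : ℝ} (hq : 0 < q) (hl : 0 ≤ l) {n K K' : ℕ} (hln : l < n) (hK : K ≤ K') :
    SK q l n K ≤ SK q l n K' := by
  have hn0 : (0:ℝ) < n := by linarith
  have hp1 : 0 < 1 - l / n := by
    rw [sub_pos, div_lt_one hn0]; exact hln
  have hx0 : 0 ≤ l / n / (1 - l / n) / q := by positivity
  rw [SK, SK]
  have := Aseq_mono (cF_nonneg hx0 K) (cF_mono hx0 le_rfl hK) n
  gcongr

lemma unif_lower {q δ : ℝ} (hq : 0 < q) (hδ : 0 < δ) {C : Set ℝ} (hC : IsCompact C)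
    (hC0 : C ⊆ Ioi 0) :
    ∃ K, ∀ᶠ n : ℕ in atTop, ∀ l ∈ C, Real.exp (n * (Gf q l - δ)) ≤ SK q l n K := by
  obtain ⟨Λ, hΛ⟩ := hC.bddAbove
  have hmain : ∃ K, ∀ᶠ n : ℕ in atTop, ∀ l ∈ C, l ∈ C → Real.exp (n * (Gf q l - δ)) ≤ SK q l n K := by
    refine hC.induction_on (p := fun D => ∃ K, ∀ᶠ n : ℕ in atTop, ∀ l ∈ D, l ∈ C →
      Real.exp (n * (Gf q l - δ)) ≤ SK q l n K) ?_ ?_ ?_ ?_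
    · exact ⟨0, by simp⟩
    · rintro s t hst ⟨K, h⟩
      refine ⟨K, ?_⟩
      filter_upwards [h] with n hn l hl using hn l (hst hl)
    · rintro s t ⟨K1, h1⟩ ⟨K2, h2⟩
      refine ⟨max K1 K2, ?_⟩
      have hnat : Tendsto (fun n : ℕ => (n : ℝ)) atTop atTop := tendsto_natCast_atTop_atTop
      filter_upwards [h1, h2, hnat.eventually_gt_atTop Λ] with n hn1 hn2 hn3 l hl hlC
      have hln : l < n := (hΛ hlC).trans_lt hn3
      have hl0 : 0 ≤ l := (hC0 hlC).le
      rcases hl with hl | hl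
      · exact (hn1 l hl hlC).trans (SK_mono hq hl0 hln (le_max_left _ _))
      · exact (hn2 l hl hlC).trans (SK_mono hq hl0 hln (le_max_right _ _))
    · intro x hx
      obtain ⟨U, hU, K, h⟩ := local_lower hq (hC0 hx) hδ
      refine ⟨U, nhdsWithin_le_nhds hU, K, ?_⟩
      filter_upwards [h] with n hn l hl _ using hn l hl
  obtain ⟨K, h⟩ := hmain
  refine ⟨K, ?_⟩
  filter_upwards [h] with n hn l hl using hn l hl hl

lemma log_bd {n : ℕ} (hn : 1 ≤ n) {Z a b : ℝ} (h1 : Real.exp (n * a) ≤ Z) (h2 : Z ≤ Real.exp (n * b)) :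
    a ≤ 1 / (n:ℝ) * Real.log Z ∧ 1 / (n:ℝ) * Real.log Z ≤ b := by
  have hn0 : (0:ℝ) < n := by exact_mod_cast hn
  have hZ : 0 < Z := (Real.exp_pos _).trans_le h1
  have g1 := (Real.le_log_iff_exp_le hZ).2 h1
  have g2 := (Real.log_le_iff_le_exp hZ).2 h2
  rw [one_div, inv_mul_eq_div, le_div_iff₀ hn0, div_le_iff₀ hn0]
  constructor <;> linarith

lemma unif_L {q δ : ℝ} (hq : 0 < q) (hδ : 0 < δ) {C : Set ℝ} (hC : IsCompact C)
    (hC0 : C ⊆ Ioi 0) :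
    ∀ᶠ n : ℕ in atTop, ∀ l ∈ C, Gf q l - δ ≤ 1 / (n:ℝ) * Real.log (Zrc n l q (Lev n)) ∧
      1 / (n:ℝ) * Real.log (Zrc n l q (Lev n)) ≤ Gf q l + δ := by
  obtain ⟨Λ, hΛ⟩ := hC.bddAbove
  obtain ⟨K, hK⟩ := unif_lower hq hδ hC hC0
  have hnat : Tendsto (fun n : ℕ => (n : ℝ)) atTop atTop := tendsto_natCast_atTop_atTop
  filter_upwards [unif_upper hq hδ hC hC0, hK, hnat.eventually_gt_atTop Λ, eventually_ge_atTop K,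
    eventually_ge_atTop 1] with n n1 n2 n3 n4 n5 l hl
  have hn0 : (0:ℝ) < n := by exact_mod_cast n5
  have hln : l < n := (hΛ hl).trans_lt n3
  have hl0 : 0 ≤ l := (hC0 hl).le
  have hz : Zrc n l q (Lev n) = SK q l n n := zL ((div_lt_one hn0).2 hln) hq
  rw [hz]
  exact log_bd n5 ((n2 l hl).trans (SK_mono hq hl0 hln n4)) (n1 l hl n)

lemma unif_B {q δ : ℝ} (hq : 0 < q) (hδ : 0 < δ) {C : Set ℝ} (hC : IsCompact C)
    (hC0 : C ⊆ Ioi 0) :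
    ∀ᶠ ε : ℝ in 𝓝[>] 0, ∀ᶠ n : ℕ in atTop, ∀ l ∈ C,
      Gf q l - δ ≤ 1 / (n:ℝ) * Real.log (Zrc n l q (Bev n (ε * n))) ∧
      1 / (n:ℝ) * Real.log (Zrc n l q (Bev n (ε * n))) ≤ Gf q l + δ := by
  obtain ⟨Λ0, hΛ0⟩ := hC.bddAbove
  set Λ := max Λ0 1 with hΛd
  have hΛ : ∀ l ∈ C, l ≤ Λ := fun l hl => (hΛ0 hl).trans (le_max_left _ _)
  have hΛp : 0 < Λ := lt_of_lt_of_le one_pos (le_max_right _ _)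
  obtain ⟨K, hK⟩ := unif_lower hq (half_pos hδ) hC hC0
  have hnat : Tendsto (fun n : ℕ => (n : ℝ)) atTop atTop := tendsto_natCast_atTop_atTop
  have e1 : ∀ᶠ ε : ℝ in 𝓝[>] 0, ε < δ / (4 * Λ) ∧ 0 < ε :=
    Filter.Eventually.and (nhdsWithin_le_nhds (gt_mem_nhds (by positivity))) eventually_mem_nhdsWithin
  filter_upwards [e1] with ε ⟨hε1, hε0⟩
  filter_upwards [unif_upper hq (half_pos hδ) hC hC0, hK, hnat.eventually_gt_atTop (2 * Λ),
    hnat.eventually_ge_atTop (K / ε), eventually_ge_atTop 1, eventually_ge_atTop K] with n n1 n2 n3 n4 n5 n6 l hl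
  have hn0 : (0:ℝ) < n := by exact_mod_cast n5
  have hlΛ := hΛ l hl
  have hln : l < n := by linarith
  have hl0 : 0 ≤ l := (hC0 hl).le
  have hp : l / n < 1 := (div_lt_one hn0).2 hln
  rw [div_le_iff₀ hε0] at n4
  have hlo : SK q l n K ≤ Zrc n l q (Bev n (ε * n)) := zB_lower hl0 hp hq (by linarith)
  have hup := zB_upper (r := ε * n) hl0 hp hq
  have hz : Zrc n l q (Lev n) = SK q l n n := zL hp hq
  rw [hz] at hup
  refine log_bd n5 ?_ ?_
  · refine le_trans ?_ ((n2 l hl).trans hlo)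
    rw [Real.exp_le_exp]
    exact mul_le_mul_of_nonneg_left (by linarith) hn0.le
  · refine hup.trans ?_
    have hnl : 0 < (n:ℝ) - l := by linarith
    have a1 : l / n / (1 - l / n) = l / (n - l) := by
      field_simp
    have a2 : l / (n - l) * (ε * n * n) ≤ n * (δ / 2) := by
      rw [div_mul_eq_mul_div, div_le_iff₀ hnl]
      rw [lt_div_iff₀ (by positivity)] at hε1
      have b1 : l * ε ≤ δ / 4 := by nlinarith
      have b2 : (n:ℝ) ≤ 2 * (n - l) := by linarith
      calc l * (ε * n * n) = (l * ε) * (n * n) := by ring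
        _ ≤ δ / 4 * (n * (2 * (n - l))) := by
          refine mul_le_mul b1 (mul_le_mul_of_nonneg_left b2 hn0.le) (by positivity) (by positivity)
        _ = _ := by ring
    rw [a1]
    calc _ ≤ Real.exp (n * (δ / 2)) * Real.exp (n * (Gf q l + δ / 2)) := by
          refine mul_le_mul (Real.exp_le_exp.2 a2) (n1 l hl n) ?_ (Real.exp_pos _).le
          exact ((Real.exp_pos _).le.trans (n2 l hl)).trans (SK_mono hq hl0 hln n6)
      _ = _ := by rw [← Real.exp_add]; congr 1; ring

end Unif

lemma liminf_limsup_bd {u : ℕ → ℝ} {a b : ℝ} (h : ∀ᶠ n in atTop, a ≤ u n ∧ u n ≤ b) :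
    (a ≤ liminf u atTop ∧ liminf u atTop ≤ b) ∧ (a ≤ limsup u atTop ∧ limsup u atTop ≤ b) := by
  have h1 : ∀ᶠ n in atTop, a ≤ u n := h.mono fun _ h => h.1
  have h2 : ∀ᶠ n in atTop, u n ≤ b := h.mono fun _ h => h.2
  have b1 : IsBoundedUnder (· ≥ ·) atTop u := isBoundedUnder_of_eventually_ge h1
  have b2 : IsBoundedUnder (· ≤ ·) atTop u := isBoundedUnder_of_eventually_le h2
  have hle := liminf_le_limsup b2 b1
  have x1 := le_liminf_of_le b2.isCoboundedUnder_ge h1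
  have x2 := limsup_le_of_le b1.isCoboundedUnder_le h2
  exact ⟨⟨x1, hle.trans x2⟩, x1.trans hle, x2⟩

lemma main_unif {q : ℝ} (hq : 0 < q) {C : Set ℝ} (hC : IsCompact C) (hC0 : C ⊆ Ioi 0) :
      (TendstoUniformlyOn (fun (ε : ℝ) (l : ℝ) =>
          Filter.liminf (fun n : ℕ =>
            (1 / (n:ℝ)) * Real.log (Zrc n l q (Bev n (ε * n)))) atTop)
        (fun l => Psi (l / q) - ((q - 1) / (2 * q)) * l + Real.log q) (𝓝[>] (0:ℝ)) C) ∧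
      (TendstoUniformlyOn (fun (ε : ℝ) (l : ℝ) =>
          Filter.limsup (fun n : ℕ =>
            (1 / (n:ℝ)) * Real.log (Zrc n l q (Bev n (ε * n)))) atTop)
        (fun l => Psi (l / q) - ((q - 1) / (2 * q)) * l + Real.log q) (𝓝[>] (0:ℝ)) C) ∧
      TendstoUniformlyOn
        (fun (n : ℕ) (l : ℝ) => (1 / (n:ℝ)) * Real.log (Zrc n l q (Lev n)))
        (fun l => Psi (l / q) - ((q - 1) / (2 * q)) * l + Real.log q) atTop C := by
  have hd : ∀ {x y e : ℝ}, 0 < e → (x - e / 2 ≤ y ∧ y ≤ x + e / 2) → dist x y < e := by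
    intro x y e he h
    rw [Real.dist_eq, abs_lt]
    constructor <;> linarith [h.1, h.2]
  refine ⟨?_, ?_, ?_⟩ <;> rw [Metric.tendstoUniformlyOn_iff] <;> intro e he
  · filter_upwards [unif_B hq (half_pos he) hC hC0] with ε hε l hl
    exact hd he (liminf_limsup_bd (hε.mono fun n h => h l hl)).1
  · filter_upwards [unif_B hq (half_pos he) hC hC0] with ε hε l hl
    exact hd he (liminf_limsup_bd (hε.mono fun n h => h l hl)).2
  · filter_upwards [unif_L hq (half_pos he) hC hC0] with n hn l hl
    exact hd he (hn l hl)

/-- Fix `q > 0` and `λ > 0` with `λ ≠ q`. Then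
`lim_{ε↓0} liminf_{n→∞} (1/n) log Z_{n,λ,q}[B_{εn}]
  = lim_{ε↓0} limsup_{n→∞} (1/n) log Z_{n,λ,q}[B_{εn}]
  = lim_{n→∞} (1/n) log Z_{n,λ,q}[L] = Ψ(λ/q) − ((q−1)/(2q))λ + log q`,
and the convergence is uniform for `λ` in compact subsets of `(0,∞) ∖ {q}`. -/
theorem stmt5 (q lam : ℝ) (hq : 0 < q) (hlam : 0 < lam) (hne : lam ≠ q) :
    (Tendsto (fun ε : ℝ =>
        Filter.liminf (fun n : ℕ =>
          (1 / (n:ℝ)) * Real.log (Zrc n lam q (Bev n (ε * n)))) atTop)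
      (𝓝[>] (0:ℝ)) (𝓝 (Psi (lam / q) - ((q - 1) / (2 * q)) * lam + Real.log q))) ∧
    (Tendsto (fun ε : ℝ =>
        Filter.limsup (fun n : ℕ =>
          (1 / (n:ℝ)) * Real.log (Zrc n lam q (Bev n (ε * n)))) atTop)
      (𝓝[>] (0:ℝ)) (𝓝 (Psi (lam / q) - ((q - 1) / (2 * q)) * lam + Real.log q))) ∧
    (Tendsto (fun n : ℕ => (1 / (n:ℝ)) * Real.log (Zrc n lam q (Lev n))) atTop
      (𝓝 (Psi (lam / q) - ((q - 1) / (2 * q)) * lam + Real.log q))) ∧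
    ∀ C : Set ℝ, IsCompact C → C ⊆ Set.Ioi (0:ℝ) \ {q} →
      (TendstoUniformlyOn (fun (ε : ℝ) (l : ℝ) =>
          Filter.liminf (fun n : ℕ =>
            (1 / (n:ℝ)) * Real.log (Zrc n l q (Bev n (ε * n)))) atTop)
        (fun l => Psi (l / q) - ((q - 1) / (2 * q)) * l + Real.log q) (𝓝[>] (0:ℝ)) C) ∧
      (TendstoUniformlyOn (fun (ε : ℝ) (l : ℝ) =>
          Filter.limsup (fun n : ℕ =>
            (1 / (n:ℝ)) * Real.log (Zrc n l q (Bev n (ε * n)))) atTop)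
        (fun l => Psi (l / q) - ((q - 1) / (2 * q)) * l + Real.log q) (𝓝[>] (0:ℝ)) C) ∧
      TendstoUniformlyOn
        (fun (n : ℕ) (l : ℝ) => (1 / (n:ℝ)) * Real.log (Zrc n l q (Lev n)))
        (fun l => Psi (l / q) - ((q - 1) / (2 * q)) * l + Real.log q) atTop C := by
  refine ⟨?_, ?_, ?_, fun C hC hC0 => main_unif hq hC (fun x hx => (hC0 hx).1)⟩
  all_goals
    have h := main_unif hq (C := {lam}) isCompact_singleton (by
      intro x hx
      rw [Set.mem_singleton_iff] at hx
      rw [hx]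
      exact hlam)
  · exact h.1.tendsto_at (Set.mem_singleton lam)
  · exact h.2.1.tendsto_at (Set.mem_singleton lam)
  · exact h.2.2.tendsto_at (Set.mem_singleton lam)
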